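/- arXiv:1212.5706 — 2 statements merged into one kernel-verified Lean document; each statement's English description precedes it below -/
import Mathlib

section
/- Let K = U(n) with n ≥ 10, and let H ⊂ U(n) be the identity component of a principal isotropy group of the action of U(n) on Λ²ℂⁿ, namely H = SU(2)^{n/2} (block diagonal) if n is even, and H = SU(2)^{(n−1)/2} × U(1) if n is odd. If G is a proper closed connected subgroup of K such that G × H acts on K with cohomogeneity at most one by left and right translations, then G = SU(n). -/
/-! Statement 13: if `K = U n` (`n ≥ 10`), `H` is the identity component of a principal
isotropy group of `U n` acting on `Λ² ℂⁿ` (block diagonal `SU(2)`-blocks, together with a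
`U(1)`-factor when `n` is odd), and `G` is a proper closed connected subgroup of `K` such
that `G × H` acts on `K` with cohomogeneity at most one, then `G = SU n`. -/
open Module

noncomputable section

/-- The tangent space at `x` of a set `S` of matrices: the span of all entrywise
velocities at `0` of curves in `S` passing through `x`. -/
def matTangentAt {m n R : Type*} [NormedAddCommGroup R] [NormedSpace ℝ R]
    (S : Set (Matrix m n R)) (x : Matrix m n R) : Submodule ℝ (Matrix m n R) :=
  Submodule.span ℝ {w | ∃ c : ℝ → Matrix m n R, (∀ t, c t ∈ S) ∧ c 0 = x ∧
    ∀ i j, HasDerivAt (fun t => c t i j) (w i j) 0}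

variable {n : Type*} {R : Type*} [Fintype n] [DecidableEq n] [Semiring R] [StarRing R]

/-- A set of square matrices is a subgroup (of a unitary group) if it contains `1` and is
closed under multiplication and conjugate transposition (= inversion, for unitary
matrices). -/
def IsMatSubgroup (G : Set (Matrix n n R)) : Prop :=
  (1 : Matrix n n R) ∈ G ∧ (∀ a ∈ G, ∀ b ∈ G, a * b ∈ G) ∧ ∀ a ∈ G, star a ∈ G

/-- The orbit of `k` under the action of `G × H` by left and right translations,
`(g, h) · k = g * k * h⁻¹` (for unitary matrices `h⁻¹ = star h`). -/
def lrOrbit (G H : Set (Matrix n n R)) (k : Matrix n n R) : Set (Matrix n n R) :=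
  {x | ∃ g ∈ G, ∃ h ∈ H, x = g * k * star h}

/-- The dimension of a matrix group: the dimension of its tangent space at `1`. -/
def grpDim [NormedAddCommGroup R] [NormedSpace ℝ R] (K : Set (Matrix n n R)) : ℕ :=
  finrank ℝ (matTangentAt K 1)

/-- The cohomogeneity of the action of `G × H` on `K` by left and right translations:
`dim K` minus the maximal orbit dimension. -/
def lrCohomogeneity [NormedAddCommGroup R] [NormedSpace ℝ R]
    (G H K : Set (Matrix n n R)) : ℕ :=
  grpDim K - ⨆ k : K, finrank ℝ (matTangentAt (lrOrbit G H k) (k : Matrix n n R))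

end

noncomputable section

/-- The unitary group `U n` as a set of complex matrices. -/
def USet (n : ℕ) : Set (Matrix (Fin n) (Fin n) ℂ) :=
  {A | star A * A = 1 ∧ A * star A = 1}

/-- The special unitary group `SU n`. -/
def SUSet (n : ℕ) : Set (Matrix (Fin n) (Fin n) ℂ) :=
  {A | A ∈ USet n ∧ A.det = 1}

/-- The identity component of a principal isotropy group of `U n` acting on `Λ² ℂⁿ`:
block-diagonal matrices with consecutive `2 × 2` blocks of determinant one
(`SU(2)^(n/2)` for `n` even, `SU(2)^((n-1)/2) × U(1)` for `n` odd, the last diagonal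
entry being an arbitrary unit scalar). -/
def AltPrincipalIsotropy (n : ℕ) : Set (Matrix (Fin n) (Fin n) ℂ) :=
  {A | A ∈ USet n ∧
    (∀ i j : Fin n, (i : ℕ) / 2 ≠ (j : ℕ) / 2 → A i j = 0) ∧
    ∀ (k : ℕ) (h : 2 * k + 1 < n),
      A ⟨2 * k, by omega⟩ ⟨2 * k, by omega⟩ * A ⟨2 * k + 1, h⟩ ⟨2 * k + 1, h⟩ -
        A ⟨2 * k, by omega⟩ ⟨2 * k + 1, h⟩ * A ⟨2 * k + 1, h⟩ ⟨2 * k, by omega⟩ = 1}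

end

theorem exists_most_frequent_value {n : ℕ} (hn : 0 < n) (d : Fin n → ℝ) :
    ∃ (a : ℝ) (p q : ℕ), (Finset.univ.filter fun i => d i = a).card = p ∧
      (Finset.univ.filter fun i => d i ≠ a).card = q ∧ p + q = n ∧ 1 ≤ p ∧
      2 * (p * q) ≤ (Finset.univ.filter fun x : Fin n × Fin n => d x.1 ≠ d x.2).card ∧
      n * q ≤ (Finset.univ.filter fun x : Fin n × Fin n => d x.1 ≠ d x.2).card := by
  classical
  have : Nonempty (Fin n) := ⟨⟨0, hn⟩⟩
  obtain ⟨i₀, hi₀⟩ := Finite.exists_max fun i : Fin n =>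
    (Finset.univ.filter fun j => d j = d i).card
  refine ⟨d i₀, _, _, rfl, rfl, ?_, ?_, ?_, ?_⟩
  · rw [Finset.card_filter_add_card_filter_not]; simp
  · exact Finset.card_pos.2 ⟨i₀, by simp⟩
  · set S := Finset.univ.filter fun i => d i = d i₀
    set T := Finset.univ.filter fun i => d i ≠ d i₀
    have hdisj : Disjoint (S ×ˢ T) (T ×ˢ S) := by
      rw [Finset.disjoint_left]
      rintro ⟨x, y⟩ h1 h2
      simp only [Finset.mem_product, S, T, Finset.mem_filter, Finset.mem_univ, true_and] at h1 h2
      exact h2.1 h1.1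
    calc 2 * (S.card * T.card) = (S ×ˢ T ∪ T ×ˢ S).card := by
          rw [Finset.card_union_of_disjoint hdisj, Finset.card_product, Finset.card_product]; ring
      _ ≤ _ := by
          apply Finset.card_le_card
          rintro ⟨x, y⟩ h
          simp only [Finset.mem_union, Finset.mem_product, S, T, Finset.mem_filter,
            Finset.mem_univ, true_and] at h ⊢
          rcases h with h | h
          · rw [h.1]; exact fun e => h.2 e.symm
          · rw [h.2]; exact h.1
  · have key : ∀ i : Fin n, (Finset.univ.filter fun j => d j ≠ d i₀).card ≤
        (Finset.univ.filter fun j => d i ≠ d j).card := by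
      intro i
      have h1 := Finset.card_filter_add_card_filter_not (s := (Finset.univ : Finset (Fin n)))
        (fun j => d j = d i₀)
      have h2 := Finset.card_filter_add_card_filter_not (s := (Finset.univ : Finset (Fin n)))
        (fun j => d j = d i)
      have h3 := hi₀ i
      have h4 : (Finset.univ.filter fun j => d i ≠ d j) =
          Finset.univ.filter fun j => ¬ d j = d i := by
        ext j; simp [eq_comm]
      rw [h4]
      simp only [ne_eq] at *
      omega
    calc n * (Finset.univ.filter fun j => d j ≠ d i₀).card
        = ∑ _i : Fin n, (Finset.univ.filter fun j => d j ≠ d i₀).card := by simp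
      _ ≤ ∑ i : Fin n, (Finset.univ.filter fun j => d i ≠ d j).card :=
          Finset.sum_le_sum fun i _ => key i
      _ = _ := by
          simp only [Finset.card_filter]
          rw [← Finset.univ_product_univ, Finset.sum_product]

theorem constant_of_few_distinct_pairs {n : ℕ} (hn : 3 ≤ n) (d : Fin n → ℝ)
    (h : (Finset.univ.filter fun x : Fin n × Fin n => d x.1 ≠ d x.2).card < 2 * n - 2) :
    ∃ a, ∀ i, d i = a := by
  obtain ⟨a, p, q, -, hq, hpq, hp, h1, -⟩ := exists_most_frequent_value (by omega) d
  refine ⟨a, ?_⟩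
  have hq0 : q = 0 := by
    by_contra hq0
    obtain ⟨p, rfl⟩ := Nat.exists_eq_add_of_le hp
    obtain ⟨q, rfl⟩ := Nat.exists_eq_add_of_le (Nat.one_le_iff_ne_zero.2 hq0)
    have : 2 * ((1 + p) * (1 + q)) < 2 * n - 2 := lt_of_le_of_lt h1 h
    have h2 : (1 + p) * (1 + q) < n - 1 := by omega
    have h3 : n - 1 = 1 + p + q := by omega
    rw [h3] at h2
    nlinarith [Nat.zero_le (p * q)]
  rw [hq0, Finset.card_eq_zero, Finset.filter_eq_empty_iff] at hq
  intro i
  simpa using hq (Finset.mem_univ i)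

theorem almost_constant_of_few_distinct_pairs {n : ℕ} (hn : 3 ≤ n) (d : Fin n → ℝ)
    (h : (Finset.univ.filter fun x : Fin n × Fin n => d x.1 ≠ d x.2).card < 4 * n - 8) :
    ∃ a i₀, ∀ i, i ≠ i₀ → d i = a := by
  obtain ⟨a, p, q, -, hq, hpq, hp, h1, h2⟩ := exists_most_frequent_value (by omega) d
  refine ⟨a, ?_⟩
  have hq1 : q ≤ 1 := by
    by_contra hq0
    rcases Nat.lt_or_ge p 2 with hp2 | hp2
    · have : q = n - 1 := by omega
      subst this
      have h3 := lt_of_le_of_lt h2 h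
      obtain ⟨m, rfl⟩ := Nat.exists_eq_add_of_le hn
      have : 3 + m - 1 = 2 + m := by omega
      rw [this] at h3
      have : 4 * (3 + m) - 8 = 4 + 4 * m := by omega
      rw [this] at h3
      nlinarith
    · obtain ⟨p, rfl⟩ := Nat.exists_eq_add_of_le hp2
      obtain ⟨q, rfl⟩ := Nat.exists_eq_add_of_le (show 2 ≤ q by omega)
      have h3 := lt_of_le_of_lt h1 h
      have : 4 * n - 8 = 8 + 4 * p + 4 * q := by omega
      rw [this] at h3
      nlinarith [Nat.zero_le (p * q)]
  rw [← hq, Finset.card_le_one] at hq1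
  by_cases hc : ∃ i, d i ≠ a
  · obtain ⟨i₀, hi₀⟩ := hc
    refine ⟨i₀, fun i hi => ?_⟩
    by_contra hia
    exact hi (hq1 i (by simpa using hia) i₀ (by simpa using hi₀))
  · push Not at hc
    exact ⟨⟨0, by omega⟩, fun i _ => hc i⟩

theorem mem_skewAdjoint_matrix_iff {n : ℕ} {X : Matrix (Fin n) (Fin n) ℂ} :
    X ∈ skewAdjoint.submodule ℝ (Matrix (Fin n) (Fin n) ℂ) ↔ star X = -X := Iff.rfl

/-- The real matrix with entries `re (X i j) + im (X i j)`. On skew-Hermitian matrices this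
is a linear isomorphism onto all real matrices. -/
def rePlusIm (n : ℕ) : Matrix (Fin n) (Fin n) ℂ →ₗ[ℝ] Matrix (Fin n) (Fin n) ℝ where
  toFun X := Matrix.of fun i j => (X i j).re + (X i j).im
  map_add' X Y := by ext i j; simp; ring
  map_smul' c X := by ext i j; simp; ring

theorem skew_apply {n : ℕ} {X : Matrix (Fin n) (Fin n) ℂ} (hX : star X = -X) (i j : Fin n) :
    star (X j i) = -X i j := by
  have := congrFun (congrFun hX i) j
  simpa [Matrix.star_apply] using this

theorem skew_apply_eq_zero {n : ℕ} {X : Matrix (Fin n) (Fin n) ℂ} (hX : star X = -X)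
    {i j : Fin n} (h1 : rePlusIm n X i j = 0) (h2 : rePlusIm n X j i = 0) : X i j = 0 := by
  have h := skew_apply hX i j
  have hre := congrArg Complex.re h
  have him := congrArg Complex.im h
  simp [rePlusIm] at h1 h2 hre him
  apply Complex.ext <;> simp <;> linarith

theorem exists_skew_diagonalization {n : ℕ} {Z : Matrix (Fin n) (Fin n) ℂ} (hZ : star Z = -Z) :
    ∃ U ∈ Matrix.unitaryGroup (Fin n) ℂ, ∃ d : Fin n → ℝ,
      Z = U * Matrix.diagonal (fun i => Complex.I * (d i : ℂ)) * star U := by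
  have hA : (-Complex.I • Z).IsHermitian := by
    rw [Matrix.IsHermitian, ← Matrix.star_eq_conjTranspose, star_smul, hZ]
    simp
  refine ⟨hA.eigenvectorUnitary, hA.eigenvectorUnitary.2, hA.eigenvalues, ?_⟩
  have h := hA.spectral_theorem
  have h2 : Z = Complex.I • (-Complex.I • Z) := by
    rw [smul_smul]; simp
  rw [Unitary.conjStarAlgAut_apply] at h
  conv_lhs => rw [h2, h]
  rw [← Matrix.smul_mul, ← Matrix.mul_smul, ← Matrix.diagonal_smul]
  rfl

theorem finrank_le_card_of_commute_diagonal {n : ℕ}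
    (C : Submodule ℝ (Matrix (Fin n) (Fin n) ℂ))
    (hC : C ≤ skewAdjoint.submodule ℝ (Matrix (Fin n) (Fin n) ℂ))
    {U : Matrix (Fin n) (Fin n) ℂ} (hU : U ∈ Matrix.unitaryGroup (Fin n) ℂ) (d : Fin n → ℝ)
    (hcomm : ∀ X ∈ C, X * (U * Matrix.diagonal (fun i => Complex.I * (d i : ℂ)) * star U) =
      (U * Matrix.diagonal (fun i => Complex.I * (d i : ℂ)) * star U) * X) :
    finrank ℝ C ≤ (Finset.univ.filter fun x : Fin n × Fin n => d x.1 = d x.2).card := by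
  classical
  have hUU : star U * U = 1 := hU.1
  have hUU' : U * star U = 1 := hU.2
  let conj : Matrix (Fin n) (Fin n) ℂ →ₗ[ℝ] Matrix (Fin n) (Fin n) ℂ :=
    { toFun := fun X => star U * X * U
      map_add' := fun X Y => by simp [mul_add, add_mul]
      map_smul' := fun c X => by simp }
  let restr : Matrix (Fin n) (Fin n) ℝ →ₗ[ℝ]
      ({x : Fin n × Fin n // d x.1 = d x.2} → ℝ) :=
    { toFun := fun M x => M x.1.1 x.1.2
      map_add' := fun X Y => by ext; simp
      map_smul' := fun c X => by ext; simp }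
  let f := ((restr ∘ₗ rePlusIm n) ∘ₗ conj) ∘ₗ C.subtype
  have hf : Function.Injective f := by
    rw [← LinearMap.ker_eq_bot, LinearMap.ker_eq_bot']
    rintro ⟨X, hX⟩ h0
    have hskew : star X = -X := hC hX
    set D := Matrix.diagonal (fun i => Complex.I * (d i : ℂ)) with hD
    have hY : star (star U * X * U) = -(star U * X * U) := by
      simp [hskew, mul_assoc]
    have hYD : (star U * X * U) * D = D * (star U * X * U) := by
      have h1 := congrArg (fun M => star U * M * U) (hcomm X hX)
      simp only [mul_assoc, hUU, mul_one] at h1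
      rw [← mul_assoc (star U) U, hUU, one_mul] at h1
      simpa only [mul_assoc] using h1
    have hzero : star U * X * U = 0 := by
      ext i j
      by_cases hij : d i = d j
      · refine skew_apply_eq_zero hY ?_ ?_
        · exact congrFun h0 ⟨(i, j), hij⟩
        · exact congrFun h0 ⟨(j, i), hij.symm⟩
      · have h1 := congrFun (congrFun hYD i) j
        rw [hD, Matrix.mul_diagonal, Matrix.diagonal_mul] at h1
        have h2 : ((d j : ℂ) - d i) ≠ 0 := by
          have h3 : d j ≠ d i := fun e => hij e.symm
          rw [sub_ne_zero]; exact_mod_cast h3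
        have h3 : (star U * X * U) i j * (Complex.I * ((d j : ℂ) - d i)) = 0 := by
          linear_combination h1
        rcases mul_eq_zero.1 h3 with h4 | h4
        · exact h4
        · rcases mul_eq_zero.1 h4 with h5 | h5
          · exact absurd h5 Complex.I_ne_zero
          · exact absurd h5 h2
    have : X = 0 := by
      calc X = (U * star U) * X * (U * star U) := by rw [hUU']; simp
        _ = U * (star U * X * U) * star U := by simp only [mul_assoc]
        _ = 0 := by rw [hzero]; simp
    exact Subtype.ext this
  calc finrank ℝ C ≤ finrank ℝ ({x : Fin n × Fin n // d x.1 = d x.2} → ℝ) :=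
        LinearMap.finrank_le_finrank_of_injective hf
    _ = _ := by rw [finrank_fintype_fun_eq_card, Fintype.card_subtype]

theorem card_eq_pairs_add_card_ne_pairs {n : ℕ} (d : Fin n → ℝ) :
    (Finset.univ.filter fun x : Fin n × Fin n => d x.1 = d x.2).card +
      (Finset.univ.filter fun x : Fin n × Fin n => d x.1 ≠ d x.2).card = n ^ 2 := by
  rw [Finset.card_filter_add_card_filter_not]
  simp [sq]

theorem finrank_skewAdjoint_matrix (n : ℕ) :
    finrank ℝ (skewAdjoint.submodule ℝ (Matrix (Fin n) (Fin n) ℂ)) = n ^ 2 := by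
  apply le_antisymm
  · have h := finrank_le_card_of_commute_diagonal _ le_rfl
      (one_mem (Matrix.unitaryGroup (Fin n) ℂ)) (fun _ => 0) (by simp)
    simpa [sq] using h
  · let g : Matrix (Fin n) (Fin n) ℝ →ₗ[ℝ] skewAdjoint.submodule ℝ (Matrix (Fin n) (Fin n) ℂ) :=
      { toFun := fun M => ⟨Matrix.of fun i j =>
            ((M i j - M j i : ℝ) : ℂ) + ((M i j + M j i : ℝ) : ℂ) * Complex.I, by
          rw [mem_skewAdjoint_matrix_iff]
          ext i j
          apply Complex.ext <;> simp [Matrix.star_apply]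
          ring⟩
        map_add' := fun X Y => by
          apply Subtype.ext; ext i j
          simp; ring
        map_smul' := fun c X => by
          apply Subtype.ext; ext i j
          simp; ring }
    have hg : Function.Injective g := by
      rw [← LinearMap.ker_eq_bot, LinearMap.ker_eq_bot']
      intro M hM
      ext i j
      have h := congrFun (congrFun (congrArg Subtype.val hM) i) j
      have hre := congrArg Complex.re h
      have him := congrArg Complex.im h
      simp [g] at hre him
      simp
      linarith
    have := LinearMap.finrank_le_finrank_of_injective hg
    rw [finrank_matrix] at this
    simpa [sq] using this

/-- The real part of the trace form `tr (X * Yᴴ)`. -/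
noncomputable def reTraceForm (n : ℕ) : LinearMap.BilinForm ℝ (Matrix (Fin n) (Fin n) ℂ) :=
  LinearMap.mk₂ ℝ (fun X Y => (Matrix.trace (X * star Y)).re)
    (fun X X' Y => by simp [add_mul]) (fun c X Y => by simp)
    (fun X Y Y' => by simp [mul_add]) (fun c X Y => by simp)

theorem reTraceForm_apply {n : ℕ} (X Y : Matrix (Fin n) (Fin n) ℂ) :
    reTraceForm n X Y = (Matrix.trace (X * star Y)).re := rfl

theorem reTraceForm_comm {n : ℕ} (X Y : Matrix (Fin n) (Fin n) ℂ) :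
    reTraceForm n X Y = reTraceForm n Y X := by
  rw [reTraceForm_apply, reTraceForm_apply]
  have h : Y * star X = star (X * star Y) := by simp
  rw [h, Matrix.star_eq_conjTranspose (X * star Y), Matrix.trace_conjTranspose]
  simp

theorem eq_zero_of_reTraceForm_self {n : ℕ} {X : Matrix (Fin n) (Fin n) ℂ}
    (h : reTraceForm n X X = 0) : X = 0 := by
  have h1 : reTraceForm n X X = ∑ i, ∑ j, Complex.normSq (X i j) := by
    rw [reTraceForm_apply, Matrix.trace, Complex.re_sum]
    refine Finset.sum_congr rfl fun i _ => ?_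
    rw [Matrix.diag_apply, Matrix.mul_apply, Complex.re_sum]
    refine Finset.sum_congr rfl fun j _ => ?_
    rw [Matrix.star_apply]
    simp [Complex.normSq_apply]
  rw [h1] at h
  ext i j
  have h2 := (Finset.sum_eq_zero_iff_of_nonneg fun i _ =>
    Finset.sum_nonneg fun j _ => Complex.normSq_nonneg (X i j)).1 h i (Finset.mem_univ i)
  have h3 := (Finset.sum_eq_zero_iff_of_nonneg fun j _ =>
    Complex.normSq_nonneg (X i j)).1 h2 j (Finset.mem_univ j)
  exact Complex.normSq_eq_zero.1 h3

theorem isCompl_reTraceForm_orthogonal {n : ℕ} (g : Submodule ℝ (Matrix (Fin n) (Fin n) ℂ)) :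
    IsCompl g ((reTraceForm n).orthogonal g) := by
  have hrefl : (reTraceForm n).IsRefl := fun X Y h => by rw [reTraceForm_comm, h]
  rw [LinearMap.BilinForm.isCompl_orthogonal_iff_disjoint hrefl, Submodule.disjoint_def]
  intro X hX hX'
  exact eq_zero_of_reTraceForm_self (hX' X hX)

/-- The orthogonal complement of `g` inside the skew-Hermitian matrices. -/
noncomputable def skewOrthogonal {n : ℕ} (g : Submodule ℝ (Matrix (Fin n) (Fin n) ℂ)) :
    Submodule ℝ (Matrix (Fin n) (Fin n) ℂ) :=
  skewAdjoint.submodule ℝ (Matrix (Fin n) (Fin n) ℂ) ⊓ (reTraceForm n).orthogonal g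

theorem mem_skewOrthogonal {n : ℕ} {g : Submodule ℝ (Matrix (Fin n) (Fin n) ℂ)}
    {Z : Matrix (Fin n) (Fin n) ℂ} : Z ∈ skewOrthogonal g ↔
      star Z = -Z ∧ ∀ X ∈ g, (Matrix.trace (X * star Z)).re = 0 := Iff.rfl

theorem finrank_add_finrank_skewOrthogonal_le {n : ℕ}
    {g : Submodule ℝ (Matrix (Fin n) (Fin n) ℂ)}
    (hg : g ≤ skewAdjoint.submodule ℝ (Matrix (Fin n) (Fin n) ℂ)) :
    finrank ℝ g + finrank ℝ (skewOrthogonal g) ≤ n ^ 2 := by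
  have hdisj : g ⊓ skewOrthogonal g = ⊥ := by
    rw [eq_bot_iff, ← (isCompl_reTraceForm_orthogonal g).inf_eq_bot]
    exact inf_le_inf_left _ inf_le_right
  have h := Submodule.finrank_sup_add_finrank_inf_eq g (skewOrthogonal g)
  rw [hdisj, finrank_bot, add_zero] at h
  rw [← h, ← finrank_skewAdjoint_matrix n]
  exact Submodule.finrank_mono (sup_le hg inf_le_left)

section Bracket

variable {n : ℕ} {g : Submodule ℝ (Matrix (Fin n) (Fin n) ℂ)}

theorem bracket_mem_skewOrthogonal
    (hg : g ≤ skewAdjoint.submodule ℝ (Matrix (Fin n) (Fin n) ℂ))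
    (hbr : ∀ X ∈ g, ∀ Y ∈ g, X * Y - Y * X ∈ g)
    {X Z : Matrix (Fin n) (Fin n) ℂ} (hX : X ∈ g) (hZ : Z ∈ skewOrthogonal g) :
    X * Z - Z * X ∈ skewOrthogonal g := by
  rw [mem_skewOrthogonal] at hZ ⊢
  have hXs : star X = -X := hg hX
  refine ⟨by simp [hXs, hZ.1], fun Y hY => ?_⟩
  have h := hZ.2 _ (hbr X hX Y hY)
  rw [hZ.1] at h
  rw [star_sub, star_mul, star_mul, hXs, hZ.1]
  have e : Matrix.trace (Y * (-Z * -X - -X * -Z)) = Matrix.trace ((X * Y - Y * X) * Z) := by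
    simp only [neg_mul_neg, mul_sub, sub_mul, Matrix.trace_sub]
    rw [← mul_assoc Y Z X, Matrix.trace_mul_comm (Y * Z) X, mul_assoc X Y Z, mul_assoc Y X Z]
  rw [e]
  simpa using h

theorem exists_almost_scalar_of_mem_skewOrthogonal (hn : 10 ≤ n)
    (hg : g ≤ skewAdjoint.submodule ℝ (Matrix (Fin n) (Fin n) ℂ))
    (hbr : ∀ X ∈ g, ∀ Y ∈ g, X * Y - Y * X ∈ g)
    (hdim : n ^ 2 ≤ finrank ℝ g + (1 + 3 * n / 2))
    {Z : Matrix (Fin n) (Fin n) ℂ} (hZ : Z ∈ skewOrthogonal g) :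
    ∃ U ∈ Matrix.unitaryGroup (Fin n) ℂ, ∃ (d : Fin n → ℝ) (a : ℝ) (i₀ : Fin n),
      (∀ i, i ≠ i₀ → d i = a) ∧
      Z = U * Matrix.diagonal (fun i => Complex.I * (d i : ℂ)) * star U := by
  have hZs := (mem_skewOrthogonal.1 hZ).1
  by_cases hZ0 : Z = 0
  · refine ⟨1, one_mem _, fun _ => 0, 0, ⟨0, by omega⟩, by simp, by simp [hZ0]⟩
  obtain ⟨U, hU, d, hd⟩ := exists_skew_diagonalization hZs
  let ad : g →ₗ[ℝ] Matrix (Fin n) (Fin n) ℂ :=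
    { toFun := fun X => X.1 * Z - Z * X.1
      map_add' := fun X Y => by simp [mul_add, add_mul]; abel
      map_smul' := fun c X => by simp [smul_sub] }
  have hrange : LinearMap.range ad < skewOrthogonal g := by
    refine lt_of_le_of_ne ?_ fun heq => hZ0 ?_
    · rintro _ ⟨X, rfl⟩
      exact bracket_mem_skewOrthogonal hg hbr X.2 hZ
    · rw [← heq] at hZ
      obtain ⟨X, hX⟩ := hZ
      have hX' : X.1 * Z - Z * X.1 = Z := hX
      apply eq_zero_of_reTraceForm_self
      have h0 : (Z * Z).trace = 0 := by
        calc (Z * Z).trace = ((X.1 * Z - Z * X.1) * Z).trace := by rw [hX']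
          _ = 0 := by
            rw [sub_mul, Matrix.trace_sub, mul_assoc Z, Matrix.trace_mul_comm Z, sub_self]
      rw [reTraceForm_apply, hZs, mul_neg, Matrix.trace_neg, h0]
      simp
  have h1 := Submodule.finrank_lt_finrank_of_lt hrange
  have h2 := LinearMap.finrank_range_add_finrank_ker ad
  have h3 : finrank ℝ (LinearMap.ker ad) ≤
      (Finset.univ.filter fun x : Fin n × Fin n => d x.1 = d x.2).card := by
    rw [← Submodule.finrank_map_subtype_eq]
    apply finrank_le_card_of_commute_diagonal _ _ hU
    · rw [← hd]
      rintro _ ⟨X, hX, rfl⟩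
      exact sub_eq_zero.1 hX
    · rintro _ ⟨X, hX, rfl⟩
      exact hg X.2
  have h4 := finrank_add_finrank_skewOrthogonal_le hg
  have h5 := card_eq_pairs_add_card_ne_pairs d
  obtain ⟨a, i₀, ha⟩ := almost_constant_of_few_distinct_pairs (by omega) d (by omega)
  exact ⟨U, hU, d, a, i₀, ha, hd⟩

theorem almost_scalar_mulVec {U : Matrix (Fin n) (Fin n) ℂ}
    (hU : U ∈ Matrix.unitaryGroup (Fin n) ℂ) {d : Fin n → ℝ} {a : ℝ} {i₀ : Fin n}
    (hd : ∀ i, i ≠ i₀ → d i = a) {y : Fin n → ℂ} (hy : (star U).mulVec y i₀ = 0) :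
    (U * Matrix.diagonal (fun i => Complex.I * (d i : ℂ)) * star U).mulVec y =
      (Complex.I * (a : ℂ)) • y := by
  have hUU' : U * star U = 1 := hU.2
  have h : (Matrix.diagonal (fun i => Complex.I * (d i : ℂ))).mulVec ((star U).mulVec y) =
      (Complex.I * (a : ℂ)) • (star U).mulVec y := by
    ext i
    rw [Matrix.mulVec_diagonal, Pi.smul_apply, smul_eq_mul]
    by_cases hi : i = i₀
    · rw [hi, hy]; simp
    · rw [hd i hi]
  rw [← Matrix.mulVec_mulVec, ← Matrix.mulVec_mulVec, h, Matrix.mulVec_smul,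
    Matrix.mulVec_mulVec, hUU', Matrix.one_mulVec]

theorem commute_of_mem_skewOrthogonal (hn : 10 ≤ n)
    (hg : g ≤ skewAdjoint.submodule ℝ (Matrix (Fin n) (Fin n) ℂ))
    (hbr : ∀ X ∈ g, ∀ Y ∈ g, X * Y - Y * X ∈ g)
    (hdim : n ^ 2 ≤ finrank ℝ g + (1 + 3 * n / 2))
    {X Z : Matrix (Fin n) (Fin n) ℂ} (hX : X ∈ g) (hZ : Z ∈ skewOrthogonal g) :
    X * Z = Z * X := by
  obtain ⟨U, hU, d, a, i₀, hd, hZd⟩ :=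
    exists_almost_scalar_of_mem_skewOrthogonal hn hg hbr hdim hZ
  obtain ⟨V, hV, e, b, j₀, he, hW⟩ :=
    exists_almost_scalar_of_mem_skewOrthogonal hn hg hbr hdim
      (bracket_mem_skewOrthogonal hg hbr hX hZ)
  let L : (Fin n → ℂ) →ₗ[ℂ] (Fin 3 → ℂ) := LinearMap.pi
    ![LinearMap.proj i₀ ∘ₗ (star U).mulVecLin,
      LinearMap.proj i₀ ∘ₗ (star U * X).mulVecLin,
      LinearMap.proj j₀ ∘ₗ (star V).mulVecLin]
  have hker : LinearMap.ker L ≠ ⊥ := by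
    apply LinearMap.ker_ne_bot_of_finrank_lt
    simp; omega
  obtain ⟨y, hy, hy0⟩ := Submodule.exists_mem_ne_zero_of_ne_bot hker
  have hy1 : (star U).mulVec y i₀ = 0 := congrFun hy 0
  have hy2 : (star U).mulVec (X.mulVec y) i₀ = 0 := by
    rw [Matrix.mulVec_mulVec]; exact congrFun hy 1
  have hy3 : (star V).mulVec y j₀ = 0 := congrFun hy 2
  have hb : b = 0 := by
    have h1 : (X * Z - Z * X).mulVec y = 0 := by
      rw [Matrix.sub_mulVec, ← Matrix.mulVec_mulVec, ← Matrix.mulVec_mulVec, hZd,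
        almost_scalar_mulVec hU hd hy1, almost_scalar_mulVec hU hd hy2, Matrix.mulVec_smul,
        sub_self]
    rw [hW, almost_scalar_mulVec hV he hy3] at h1
    simpa [hy0] using h1
  subst hb
  have htr : Matrix.trace (X * Z - Z * X) = 0 := by
    rw [Matrix.trace_sub, Matrix.trace_mul_comm, sub_self]
  rw [hW, mul_assoc, Matrix.trace_mul_comm, mul_assoc, show star V * V = 1 from hV.1, mul_one,
    Matrix.trace_diagonal, Finset.sum_eq_single j₀ (fun i _ hi => by simp [he i hi])
      (by simp)] at htr
  have hj : e j₀ = 0 := by simpa using htr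
  have he0 : (fun i => Complex.I * (e i : ℂ)) = 0 := by
    ext i
    by_cases hi : i = j₀
    · simp [hi, hj]
    · simp [he i hi]
  rw [he0] at hW
  exact sub_eq_zero.1 (by rw [hW]; simp)

theorem scalar_of_mem_skewOrthogonal (hn : 10 ≤ n)
    (hg : g ≤ skewAdjoint.submodule ℝ (Matrix (Fin n) (Fin n) ℂ))
    (hbr : ∀ X ∈ g, ∀ Y ∈ g, X * Y - Y * X ∈ g)
    (hdim : n ^ 2 ≤ finrank ℝ g + (1 + 3 * n / 2))
    {Z : Matrix (Fin n) (Fin n) ℂ} (hZ : Z ∈ skewOrthogonal g) :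
    ∃ a : ℝ, Z = (Complex.I * (a : ℂ)) • (1 : Matrix (Fin n) (Fin n) ℂ) := by
  obtain ⟨U, hU, d, hd⟩ := exists_skew_diagonalization (mem_skewOrthogonal.1 hZ).1
  have h1 := finrank_le_card_of_commute_diagonal g hg hU d fun X hX => by
    rw [← hd]; exact commute_of_mem_skewOrthogonal hn hg hbr hdim hX hZ
  have h2 := card_eq_pairs_add_card_ne_pairs d
  obtain ⟨a, ha⟩ := constant_of_few_distinct_pairs (by omega) d (by omega)
  refine ⟨a, ?_⟩
  have h3 : Matrix.diagonal (fun i => Complex.I * (d i : ℂ)) =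
      (Complex.I * (a : ℂ)) • (1 : Matrix (Fin n) (Fin n) ℂ) := by
    rw [Matrix.smul_one_eq_diagonal]
    congr 1
    ext i
    rw [ha]
  rw [hd, h3, Matrix.mul_smul, Matrix.smul_mul, mul_one, show U * star U = 1 from hU.2]

/-- A Lie algebra of skew-Hermitian matrices of small codimension contains all traceless
skew-Hermitian matrices. -/
theorem traceless_skew_mem (hn : 10 ≤ n)
    (hg : g ≤ skewAdjoint.submodule ℝ (Matrix (Fin n) (Fin n) ℂ))
    (hbr : ∀ X ∈ g, ∀ Y ∈ g, X * Y - Y * X ∈ g)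
    (hdim : n ^ 2 ≤ finrank ℝ g + (1 + 3 * n / 2))
    {Y : Matrix (Fin n) (Fin n) ℂ} (hY : star Y = -Y) (htr : Y.trace = 0) : Y ∈ g := by
  have hmem : Y ∈ g ⊔ (reTraceForm n).orthogonal g := by
    rw [(isCompl_reTraceForm_orthogonal g).sup_eq_top]; trivial
  obtain ⟨X, hX, Z, hZ, rfl⟩ := Submodule.mem_sup.1 hmem
  have hXs : star X = -X := hg hX
  have hZm : Z ∈ skewOrthogonal g := by
    refine ⟨?_, hZ⟩
    change star Z = -Z
    rw [star_add, hXs, neg_add] at hY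
    exact add_left_cancel hY
  obtain ⟨a, rfl⟩ := scalar_of_mem_skewOrthogonal hn hg hbr hdim hZm
  have h1 := (mem_skewOrthogonal.1 hZm).2 X hX
  rw [(mem_skewOrthogonal.1 hZm).1] at h1
  have h2 := congrArg Complex.im htr
  simp at h1 h2
  have hn0 : (n : ℝ) ≠ 0 := by positivity
  have ha : a = 0 := by
    rcases h1 with h1 | h1
    · exact h1
    · rw [h1, zero_add] at h2
      rcases mul_eq_zero.1 h2 with h3 | h3
      · exact h3
      · exact absurd h3 hn0
  simpa [ha] using hX

end Bracket

section ClosedSubgroups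

open scoped Matrix.Norms.L2Operator Topology
open Filter

/-- A closed subgroup of the unitary group, given as a set of matrices. -/
structure IsClosedUnitarySubgroup {n : ℕ} (G : Set (Matrix (Fin n) (Fin n) ℂ)) : Prop where
  subset : G ⊆ USet n
  one_mem : (1 : Matrix (Fin n) (Fin n) ℂ) ∈ G
  mul_mem : ∀ a ∈ G, ∀ b ∈ G, a * b ∈ G
  star_mem : ∀ a ∈ G, star a ∈ G
  isClosed : IsClosed G

variable {n : ℕ} {G H : Set (Matrix (Fin n) (Fin n) ℂ)}

theorem mem_unitary_of_mem_USet {k : Matrix (Fin n) (Fin n) ℂ} (hk : k ∈ USet n) :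
    k ∈ unitary (Matrix (Fin n) (Fin n) ℂ) := hk

namespace IsClosedUnitarySubgroup

theorem pow_mem (hG : IsClosedUnitarySubgroup G) {a : Matrix (Fin n) (Fin n) ℂ} (ha : a ∈ G)
    (m : ℕ) : a ^ m ∈ G := by
  induction m with
  | zero => simpa using hG.one_mem
  | succ m ih => rw [pow_succ]; exact hG.mul_mem _ ih _ ha

theorem isCompact (hG : IsClosedUnitarySubgroup G) : IsCompact G := by
  have : ProperSpace (Matrix (Fin n) (Fin n) ℂ) := FiniteDimensional.proper ℝ _
  refine Metric.isCompact_of_isClosed_isBounded hG.isClosed ?_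
  refine (Metric.isBounded_closedBall (x := (0 : Matrix (Fin n) (Fin n) ℂ))
    (r := ‖(1 : Matrix (Fin n) (Fin n) ℂ)‖)).subset fun g hg => ?_
  rw [mem_closedBall_zero_iff, ← CStarRing.norm_mem_unitary_mul 1 (hG.subset hg), mul_one]

end IsClosedUnitarySubgroup

theorem exp_skew_mem_USet {X : Matrix (Fin n) (Fin n) ℂ} (hX : star X = -X) :
    NormedSpace.exp X ∈ USet n := by
  let _ : NormedAlgebra ℚ (Matrix (Fin n) (Fin n) ℂ) := .restrictScalars ℚ ℝ _
  exact NormedSpace.exp_mem_unitary_of_mem_skewAdjoint hX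

theorem star_smul_of_skew {X : Matrix (Fin n) (Fin n) ℂ} (hX : star X = -X) (t : ℝ) :
    star (t • X) = -(t • X) := by
  rw [star_smul, hX]; simp

theorem star_exp_of_skew {X : Matrix (Fin n) (Fin n) ℂ} (hX : star X = -X) (t : ℝ) :
    star (NormedSpace.exp (t • X)) = NormedSpace.exp ((-t) • X) := by
  rw [NormedSpace.star_exp, star_smul_of_skew hX, neg_smul]

theorem exp_unitary_conj {U : Matrix (Fin n) (Fin n) ℂ} (hU : U ∈ USet n)
    (A : Matrix (Fin n) (Fin n) ℂ) :
    NormedSpace.exp (U * A * star U) = U * NormedSpace.exp A * star U := by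
  have h : U⁻¹ = star U := Matrix.inv_eq_left_inv hU.1
  rw [← h]
  exact Matrix.exp_conj U A (IsUnit.of_mul_eq_one (star U) hU.2)

theorem norm_pow_sub_pow_le {u v : Matrix (Fin n) (Fin n) ℂ} (hu : u ∈ USet n)
    (hv : v ∈ USet n) (m : ℕ) : ‖u ^ m - v ^ m‖ ≤ m * ‖u - v‖ := by
  induction m with
  | zero => simp
  | succ m ih =>
    have e : u ^ (m + 1) - v ^ (m + 1) = u ^ m * (u - v) + (u ^ m - v ^ m) * v := by
      rw [pow_succ, pow_succ]; noncomm_ring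
    have hum : u ^ m ∈ unitary (Matrix (Fin n) (Fin n) ℂ) :=
      pow_mem (mem_unitary_of_mem_USet hu) m
    calc ‖u ^ (m + 1) - v ^ (m + 1)‖ ≤ ‖u ^ m * (u - v)‖ + ‖(u ^ m - v ^ m) * v‖ := by
          rw [e]; exact norm_add_le _ _
      _ = ‖u - v‖ + ‖u ^ m - v ^ m‖ := by
          rw [CStarRing.norm_mem_unitary_mul _ hum, CStarRing.norm_mul_mem_unitary _ hv]
      _ ≤ ‖u - v‖ + m * ‖u - v‖ := by gcongr
      _ = _ := by push_cast; ring

theorem tendsto_exp_slope (Z : Matrix (Fin n) (Fin n) ℂ) :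
    Tendsto (fun t : ℝ => t⁻¹ • (NormedSpace.exp (t • Z) - 1)) (𝓝[>] 0) (𝓝 Z) := by
  have h := (hasDerivAt_exp_smul_const (𝕂 := ℝ) Z 0).tendsto_slope_zero_right
  simpa [NormedSpace.exp_zero] using h

theorem tendsto_one_of_tendsto_slope {ι : Type*} {l : Filter ι}
    {g : ι → Matrix (Fin n) (Fin n) ℂ} {s : ι → ℝ} {Z : Matrix (Fin n) (Fin n) ℂ}
    (hpos : ∀ᶠ i in l, 0 < s i) (hs : Tendsto s l (𝓝 0))
    (hZ : Tendsto (fun i => (s i)⁻¹ • (g i - 1)) l (𝓝 Z)) : Tendsto g l (𝓝 1) := by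
  have h : Tendsto (fun i => 1 + s i • ((s i)⁻¹ • (g i - 1))) l (𝓝 (1 + (0 : ℝ) • Z)) :=
    tendsto_const_nhds.add (hs.smul hZ)
  rw [zero_smul, add_zero] at h
  refine h.congr' ?_
  filter_upwards [hpos] with i hi
  rw [smul_smul, mul_inv_cancel₀ hi.ne', one_smul]; abel

theorem skew_of_tendsto_slope {ι : Type*} {l : Filter ι} [l.NeBot]
    {g : ι → Matrix (Fin n) (Fin n) ℂ} {s : ι → ℝ} {Z : Matrix (Fin n) (Fin n) ℂ}
    (hg : ∀ᶠ i in l, g i ∈ USet n) (hpos : ∀ᶠ i in l, 0 < s i) (hs : Tendsto s l (𝓝 0))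
    (hZ : Tendsto (fun i => (s i)⁻¹ • (g i - 1)) l (𝓝 Z)) : star Z = -Z := by
  have hg1 := tendsto_one_of_tendsto_slope hpos hs hZ
  have h1 : Tendsto (fun i => star ((s i)⁻¹ • (g i - 1))) l (𝓝 (star Z)) :=
    (continuous_star.tendsto Z).comp hZ
  have h2 : Tendsto (fun i => -(star (g i) * ((s i)⁻¹ • (g i - 1)))) l
      (𝓝 (-(star (1 : Matrix (Fin n) (Fin n) ℂ) * Z))) :=
    (((continuous_star.tendsto _).comp hg1).mul hZ).neg
  rw [star_one, one_mul] at h2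
  refine tendsto_nhds_unique (h1.congr' ?_) h2
  filter_upwards [hg] with i hi
  have hi1 : star (g i) * g i = 1 := hi.1
  rw [star_smul, star_sub, star_one, mul_smul_comm, mul_sub, hi1, ← smul_neg]
  simp

/-- If elements of a closed subgroup approach `1` with limiting direction `Z`, then `Z`
generates a one-parameter subgroup. -/
theorem exp_mem_of_tendsto_slope (hG : IsClosedUnitarySubgroup G) {ι : Type*} {l : Filter ι}
    [l.NeBot] {g : ι → Matrix (Fin n) (Fin n) ℂ} {s : ι → ℝ} {Z : Matrix (Fin n) (Fin n) ℂ}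
    (hg : ∀ᶠ i in l, g i ∈ G) (hpos : ∀ᶠ i in l, 0 < s i) (hs : Tendsto s l (𝓝 0))
    (hZ : Tendsto (fun i => (s i)⁻¹ • (g i - 1)) l (𝓝 Z)) (t : ℝ) :
    NormedSpace.exp (t • Z) ∈ G := by
  let _ : NormedAlgebra ℚ (Matrix (Fin n) (Fin n) ℂ) := .restrictScalars ℚ ℝ _
  have hskew : star Z = -Z :=
    skew_of_tendsto_slope (hg.mono fun i hi => hG.subset hi) hpos hs hZ
  have main : ∀ t : ℝ, 0 ≤ t → NormedSpace.exp (t • Z) ∈ G := by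
    intro t ht
    have hs' : Tendsto s l (𝓝[>] 0) :=
      tendsto_nhdsWithin_iff.2 ⟨hs, hpos⟩
    have hexp := (tendsto_exp_slope Z).comp hs'
    have hdiff : Tendsto (fun i => t * ‖(s i)⁻¹ • (g i - NormedSpace.exp (s i • Z))‖) l (𝓝 0) := by
      have h := ((hZ.sub hexp).norm).const_mul t
      rw [sub_self, norm_zero, mul_zero] at h
      refine h.congr fun i => ?_
      simp only [Function.comp_apply]
      rw [← smul_sub]
      congr 3
      abel
    have hpow : Tendsto (fun i => g i ^ ⌊t / s i⌋₊ -
        NormedSpace.exp (s i • Z) ^ ⌊t / s i⌋₊) l (𝓝 0) := by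
      refine squeeze_zero_norm' ?_ hdiff
      filter_upwards [hg, hpos] with i hi hsi
      refine (norm_pow_sub_pow_le (hG.subset hi)
        (exp_skew_mem_USet (star_smul_of_skew hskew _)) _).trans ?_
      rw [norm_smul, norm_inv, Real.norm_of_nonneg hsi.le, ← mul_assoc, ← div_eq_mul_inv]
      gcongr
      exact Nat.floor_le (by positivity)
    have hfl : Tendsto (fun i => (⌊t / s i⌋₊ : ℝ) * s i) l (𝓝 t) := by
      have h1 : Tendsto (fun i => t - s i) l (𝓝 t) := by
        simpa using tendsto_const_nhds.sub hs
      refine tendsto_of_tendsto_of_tendsto_of_le_of_le' h1 tendsto_const_nhds ?_ ?_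
      · filter_upwards [hpos] with i hsi
        have h2 := Nat.lt_floor_add_one (t / s i)
        rw [div_lt_iff₀ hsi] at h2
        linarith
      · filter_upwards [hpos] with i hsi
        have h2 := Nat.floor_le (show 0 ≤ t / s i by positivity)
        rwa [le_div_iff₀ hsi] at h2
    have hlim : Tendsto (fun i => NormedSpace.exp (s i • Z) ^ ⌊t / s i⌋₊) l
        (𝓝 (NormedSpace.exp (t • Z))) := by
      have h1 : Tendsto (fun i => NormedSpace.exp (((⌊t / s i⌋₊ : ℝ) * s i) • Z)) l
          (𝓝 (NormedSpace.exp (t • Z))) :=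
        (NormedSpace.exp_continuous.tendsto _).comp (hfl.smul_const Z)
      refine h1.congr fun i => ?_
      rw [← NormedSpace.exp_nsmul, mul_smul, Nat.cast_smul_eq_nsmul]
    have hfin := hpow.add hlim
    rw [zero_add] at hfin
    refine hG.isClosed.mem_of_tendsto hfin ?_
    filter_upwards [hg] with i hi
    rw [sub_add_cancel]
    exact hG.pow_mem hi _
  rcases le_total 0 t with ht | ht
  · exact main t ht
  · have h := hG.star_mem _ (main (-t) (by linarith))
    rwa [star_exp_of_skew hskew, neg_neg] at h

theorem skew_of_exp_mem (hG : IsClosedUnitarySubgroup G) {X : Matrix (Fin n) (Fin n) ℂ}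
    (hX : ∀ t : ℝ, NormedSpace.exp (t • X) ∈ G) : star X = -X :=
  skew_of_tendsto_slope (l := 𝓝[>] (0 : ℝ)) (s := id)
    (Eventually.of_forall fun t => hG.subset (hX t))
    self_mem_nhdsWithin (tendsto_id.mono_left nhdsWithin_le_nhds) (tendsto_exp_slope X)

/-- The Lie algebra of a closed subgroup of the unitary group. -/
noncomputable def lieAlg (hG : IsClosedUnitarySubgroup G) :
    Submodule ℝ (Matrix (Fin n) (Fin n) ℂ) where
  carrier := {X | ∀ t : ℝ, NormedSpace.exp (t • X) ∈ G}
  zero_mem' := fun t => by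
    rw [smul_zero, NormedSpace.exp_zero]; exact hG.one_mem
  smul_mem' := fun c X hX t => by
    rw [smul_smul]; exact hX _
  add_mem' := fun {X Y} hX hY => by
    refine exp_mem_of_tendsto_slope hG (l := 𝓝[>] (0 : ℝ)) (s := id)
      (g := fun t => NormedSpace.exp (t • X) * NormedSpace.exp (t • Y))
      (Eventually.of_forall fun t => hG.mul_mem _ (hX t) _ (hY t)) self_mem_nhdsWithin
      (tendsto_id.mono_left nhdsWithin_le_nhds) ?_
    have h := ((hasDerivAt_exp_smul_const (𝕂 := ℝ) X 0).mul
      (hasDerivAt_exp_smul_const (𝕂 := ℝ) Y 0)).tendsto_slope_zero_right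
    simpa [NormedSpace.exp_zero] using h

theorem lieAlg_le_skew (hG : IsClosedUnitarySubgroup G) :
    lieAlg hG ≤ skewAdjoint.submodule ℝ (Matrix (Fin n) (Fin n) ℂ) :=
  fun _ hX => skew_of_exp_mem hG hX

theorem bracket_mem_lieAlg (hG : IsClosedUnitarySubgroup G) :
    ∀ X ∈ lieAlg hG, ∀ Y ∈ lieAlg hG, X * Y - Y * X ∈ lieAlg hG := by
  intro X hX Y hY
  have hXs : star X = -X := skew_of_exp_mem hG hX
  have hconj : ∀ t : ℝ,
      NormedSpace.exp (t • X) * Y * NormedSpace.exp (t • -X) ∈ lieAlg hG := by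
    intro t s
    have h1 : NormedSpace.exp (t • -X) = star (NormedSpace.exp (t • X)) := by
      rw [star_exp_of_skew hXs, smul_neg, neg_smul]
    rw [h1, ← Matrix.smul_mul, ← Matrix.mul_smul,
      exp_unitary_conj (exp_skew_mem_USet (star_smul_of_skew hXs t))]
    exact hG.mul_mem _ (hG.mul_mem _ (hX t) _ (hY s)) _ (hG.star_mem _ (hX t))
  have hder := (((hasDerivAt_exp_smul_const (𝕂 := ℝ) X 0).mul_const Y).mul
      (hasDerivAt_exp_smul_const (𝕂 := ℝ) (-X) 0)).tendsto_slope_zero_right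
  have hder' : Tendsto (fun t : ℝ => t⁻¹ •
      (NormedSpace.exp (t • X) * Y * NormedSpace.exp (t • -X) - Y)) (𝓝[>] 0)
      (𝓝 (X * Y - Y * X)) := by
    simpa [NormedSpace.exp_zero, sub_eq_add_neg] using hder
  refine (lieAlg hG).closed_of_finiteDimensional.mem_of_tendsto hder'
    (Eventually.of_forall fun t => ?_)
  refine (lieAlg hG).smul_mem _ ((lieAlg hG).sub_mem (hconj t) hY)

theorem exists_ultrafilter_limit {ι X : Type*} [TopologicalSpace X] (l : Ultrafilter ι)
    {K : Set X} (hK : IsCompact K) {f : ι → X} (hf : ∀ᶠ i in l, f i ∈ K) :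
    ∃ a ∈ K, Tendsto f l (𝓝 a) :=
  hK.ultrafilter_le_nhds' (l.map f) hf

/-- Velocities at `1` of curves in the product set of two closed subgroups lie in the sum of
the Lie algebras. -/
theorem velocity_mem_of_product (hG : IsClosedUnitarySubgroup G)
    (hH : IsClosedUnitarySubgroup H) {c : ℝ → Matrix (Fin n) (Fin n) ℂ}
    (hc : ∀ t, ∃ h ∈ H, c t * h ∈ G) {w : Matrix (Fin n) (Fin n) ℂ}
    (hw : Tendsto (fun t : ℝ => t⁻¹ • (c t - 1)) (𝓝[>] 0) (𝓝 w)) :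
    ∃ X ∈ lieAlg hG, ∃ Y ∈ lieAlg hH, w = X - Y := by
  have : ProperSpace (Matrix (Fin n) (Fin n) ℂ) := FiniteDimensional.proper ℝ _
  have hcU : ∀ t, c t ∈ USet n := by
    intro t
    obtain ⟨h, hh, hch⟩ := hc t
    have e : c t = c t * h * star h := by
      rw [mul_assoc, (hH.subset hh).2, mul_one]
    rw [e]
    exact mul_mem (mem_unitary_of_mem_USet (hG.subset hch))
      (mem_unitary_of_mem_USet (hH.subset (hH.star_mem _ hh)))
  let S : ℝ → Set (Matrix (Fin n) (Fin n) ℂ) := fun t => G ∩ {g | star (c t) * g ∈ H}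
  have hmin : ∀ t, ∃ g ∈ S t, ∀ g' ∈ S t, ‖g - 1‖ ≤ ‖g' - 1‖ := by
    intro t
    have hcomp : IsCompact (S t) :=
      hG.isCompact.inter_right (hH.isClosed.preimage (continuous_const.mul continuous_id))
    have hne : (S t).Nonempty := by
      obtain ⟨h, hh, hch⟩ := hc t
      refine ⟨c t * h, hch, ?_⟩
      change star (c t) * (c t * h) ∈ H
      rwa [← mul_assoc, (hcU t).1, one_mul]
    obtain ⟨g, hg, hgmin⟩ := hcomp.exists_isMinOn hne
      (f := fun g => ‖g - 1‖) (by fun_prop)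
    exact ⟨g, hg, fun g' hg' => hgmin hg'⟩
  choose g hgS hgmin using hmin
  have hgG : ∀ t, g t ∈ G := fun t => (hgS t).1
  have hhH : ∀ t, star (c t) * g t ∈ H := fun t => (hgS t).2
  have htrans : ∀ t, ∀ a ∈ G, a ∈ H → g t * a ∈ S t := fun t a haG haH =>
    ⟨hG.mul_mem _ (hgG t) _ haG, by
      change star (c t) * (g t * a) ∈ H
      rw [← mul_assoc]
      exact hH.mul_mem _ (hhH t) _ haH⟩
  let l : Ultrafilter ℝ := Ultrafilter.of (𝓝[>] (0 : ℝ))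
  have hl : (l : Filter ℝ) ≤ 𝓝[>] (0 : ℝ) := Ultrafilter.of_le _
  have hpos : ∀ᶠ t in (l : Filter ℝ), 0 < t := hl self_mem_nhdsWithin
  have hl0 : Tendsto (fun t : ℝ => t) l (𝓝 0) := hl.trans nhdsWithin_le_nhds
  have hwl := hw.mono_left hl
  have hc1 : Tendsto c l (𝓝 1) := tendsto_one_of_tendsto_slope hpos hl0 hwl
  have hcs1 : Tendsto (fun t => star (c t)) l (𝓝 1) := by
    have h := (continuous_star.tendsto (1 : Matrix (Fin n) (Fin n) ℂ)).comp hc1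
    rwa [star_one] at h
  have hg1 : Tendsto (fun t => ‖g t - 1‖) l (𝓝 0) := by
    obtain ⟨a, haG, ha⟩ := exists_ultrafilter_limit l hG.isCompact
      (Eventually.of_forall hgG)
    have haH : a ∈ H := by
      have h := hcs1.mul ha
      rw [one_mul] at h
      exact hH.isClosed.mem_of_tendsto h (Eventually.of_forall hhH)
    have h := ((ha.mul_const (star a)).sub_const 1).norm
    rw [(hG.subset haG).2, sub_self, norm_zero] at h
    exact squeeze_zero (fun t => norm_nonneg _)
      (fun t => hgmin t _ (htrans t _ (hG.star_mem _ haG) (hH.star_mem _ haH))) h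
  have hsub : ∀ t r : ℝ, r⁻¹ • (star (c t) * g t - 1) =
      star (c t) * (r⁻¹ • (g t - 1) - r⁻¹ • (c t - 1)) := by
    intro t r
    rw [← smul_sub, mul_smul_comm, sub_sub_sub_cancel_right, mul_sub, (hcU t).1]
  have hbdd : ∃ C : ℝ, ∀ᶠ t in (l : Filter ℝ), ‖g t - 1‖ ≤ C * t := by
    by_contra! hcon
    have hrpos : ∀ᶠ t in (l : Filter ℝ), 0 < ‖g t - 1‖ := by simpa using hcon 0
    have hratio : Tendsto (fun t => ‖g t - 1‖⁻¹ * t) l (𝓝 0) := by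
      rw [Metric.tendsto_nhds]
      intro ε hε
      filter_upwards [hrpos, hpos, hcon ε⁻¹] with t h1 h2 h3
      rw [Real.dist_eq, sub_zero, abs_of_pos (by positivity), inv_mul_lt_iff₀ h1]
      rwa [inv_mul_lt_iff₀ hε, mul_comm] at h3
    obtain ⟨Z, hZs, hZ⟩ := exists_ultrafilter_limit l
      (isCompact_sphere (0 : Matrix (Fin n) (Fin n) ℂ) 1)
      (f := fun t => ‖g t - 1‖⁻¹ • (g t - 1)) (by
        filter_upwards [hrpos] with t h1
        rw [mem_sphere_zero_iff_norm, norm_smul, norm_inv, norm_norm, inv_mul_cancel₀ h1.ne'])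
    have hZG := exp_mem_of_tendsto_slope hG (Eventually.of_forall hgG) hrpos hg1 hZ
    have hcw : Tendsto (fun t => ‖g t - 1‖⁻¹ • (c t - 1)) l (𝓝 0) := by
      have h := hratio.smul hwl
      rw [zero_smul] at h
      refine h.congr' ?_
      filter_upwards [hpos] with t ht
      rw [smul_smul, mul_assoc, mul_inv_cancel₀ ht.ne', mul_one]
    have hhZ : Tendsto (fun t => ‖g t - 1‖⁻¹ • (star (c t) * g t - 1)) l (𝓝 Z) := by
      have h := hcs1.mul (hZ.sub hcw)
      rw [sub_zero, one_mul] at h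
      exact h.congr fun t => (hsub t _).symm
    have hZH := exp_mem_of_tendsto_slope hH (Eventually.of_forall hhH) hrpos hg1 hhZ
    have hZskew : star Z = -Z := skew_of_exp_mem hG hZG
    have hexp := (tendsto_exp_slope Z).comp (tendsto_nhdsWithin_iff.2 ⟨hg1, hrpos⟩)
    have hlim := (hZ.sub hexp).norm
    rw [sub_self, norm_zero] at hlim
    have hge : ∀ᶠ t in (l : Filter ℝ), 1 ≤ ‖‖g t - 1‖⁻¹ • (g t - 1) -
        ‖g t - 1‖⁻¹ • (NormedSpace.exp (‖g t - 1‖ • Z) - 1)‖ := by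
      filter_upwards [hrpos] with t h1
      set r := ‖g t - 1‖ with hr
      have h2 : r ≤ ‖g t - NormedSpace.exp (r • Z)‖ := by
        have h3 := hgmin t _ (htrans t _ (hG.star_mem _ (hZG r)) (hH.star_mem _ (hZH r)))
        have hE : star (NormedSpace.exp (r • Z)) ∈ USet n :=
          hG.subset (hG.star_mem _ (hZG r))
        rw [← CStarRing.norm_mul_mem_unitary _ (mem_unitary_of_mem_USet hE), sub_mul,
          (hG.subset (hZG r)).2]
        exact h3
      rw [← smul_sub, sub_sub_sub_cancel_right, norm_smul, norm_inv,
        Real.norm_of_nonneg h1.le, le_inv_mul_iff₀ h1, mul_one]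
      exact h2
    have := ge_of_tendsto hlim hge
    linarith
  obtain ⟨C, hC⟩ := hbdd
  obtain ⟨X, -, hX⟩ := exists_ultrafilter_limit l
    (isCompact_closedBall (0 : Matrix (Fin n) (Fin n) ℂ) C)
    (f := fun t => t⁻¹ • (g t - 1)) (by
      filter_upwards [hpos, hC] with t h1 h2
      rw [mem_closedBall_zero_iff, norm_smul, norm_inv, Real.norm_of_nonneg h1.le,
        inv_mul_le_iff₀ h1, mul_comm]
      exact h2)
  have hXw : Tendsto (fun t => t⁻¹ • (star (c t) * g t - 1)) l (𝓝 (X - w)) := by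
    have h := hcs1.mul (hX.sub hwl)
    rw [one_mul] at h
    exact h.congr fun t => (hsub t _).symm
  exact ⟨X, exp_mem_of_tendsto_slope hG (Eventually.of_forall hgG) hpos hl0 hX, X - w,
    exp_mem_of_tendsto_slope hH (Eventually.of_forall hhH) hpos hl0 hXw, by abel⟩

theorem tendsto_slope_of_hasDerivAt_entries {c : ℝ → Matrix (Fin n) (Fin n) ℂ}
    {w : Matrix (Fin n) (Fin n) ℂ}
    (h : ∀ i j, HasDerivAt (fun t => c t i j) (w i j) 0) :
    Tendsto (fun t : ℝ => t⁻¹ • (c t - c 0)) (𝓝[>] 0) (𝓝 w) := by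
  refine tendsto_pi_nhds.2 fun i => tendsto_pi_nhds.2 fun j => ?_
  simpa using (h i j).tendsto_slope_zero_right

theorem hasDerivAt_entries {c : ℝ → Matrix (Fin n) (Fin n) ℂ} {w : Matrix (Fin n) (Fin n) ℂ}
    {t : ℝ} (h : HasDerivAt c w t) (i j : Fin n) :
    HasDerivAt (fun t => c t i j) (w i j) t :=
  (LinearMap.toContinuousLinearMap
    (Matrix.entryLinearMap ℝ ℂ i j)).hasFDerivAt.comp_hasDerivAt t h

theorem IsClosedUnitarySubgroup.conj (hH : IsClosedUnitarySubgroup H)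
    {k : Matrix (Fin n) (Fin n) ℂ} (hk : k ∈ USet n) :
    IsClosedUnitarySubgroup {x | star k * x * k ∈ H} where
  subset x hx := by
    have e : x = k * (star k * x * k) * star k := by
      simp only [mul_assoc, hk.2, mul_one]
      rw [← mul_assoc k, hk.2, one_mul]
    have hk' : k ∈ unitary (Matrix (Fin n) (Fin n) ℂ) := hk
    rw [e]
    exact MulMemClass.mul_mem (MulMemClass.mul_mem hk' (mem_unitary_of_mem_USet (hH.subset hx)))
      (Unitary.star_mem hk')
  one_mem := by
    change star k * 1 * k ∈ H
    rw [mul_one, hk.1]; exact hH.one_mem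
  mul_mem a ha b hb := by
    change star k * (a * b) * k ∈ H
    have e : star k * (a * b) * k = (star k * a * k) * (star k * b * k) := by
      simp only [mul_assoc]
      rw [← mul_assoc k (star k), hk.2, one_mul]
    rw [e]; exact hH.mul_mem _ ha _ hb
  star_mem a ha := by
    change star k * star a * k ∈ H
    have := hH.star_mem _ ha
    simpa [mul_assoc] using this
  isClosed := hH.isClosed.preimage
    ((continuous_const.mul continuous_id).mul continuous_const)

theorem finrank_tangent_lrOrbit_le (hG : IsClosedUnitarySubgroup G)
    (hH : IsClosedUnitarySubgroup H) {k : Matrix (Fin n) (Fin n) ℂ} (hk : k ∈ USet n) :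
    finrank ℝ (matTangentAt (lrOrbit G H k) k) ≤
      finrank ℝ (lieAlg hG) + finrank ℝ (lieAlg hH) := by
  let f : lieAlg hG × lieAlg hH →ₗ[ℝ] Matrix (Fin n) (Fin n) ℂ :=
    { toFun := fun p => p.1.1 * k - k * p.2.1
      map_add' := fun p q => by simp [mul_add, add_mul]; abel
      map_smul' := fun c p => by simp [smul_sub] }
  have hle : matTangentAt (lrOrbit G H k) k ≤ LinearMap.range f := by
    refine Submodule.span_le.2 ?_
    rintro w ⟨c, hc, hc0, hder⟩
    have hslope := tendsto_slope_of_hasDerivAt_entries hder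
    have hK := hH.conj hk
    have hcK : ∀ t, ∃ h ∈ {x | star k * x * k ∈ H}, c t * star k * h ∈ G := by
      intro t
      obtain ⟨a, ha, h, hh, e⟩ := hc t
      refine ⟨k * h * star k, ?_, ?_⟩
      · change star k * (k * h * star k) * k ∈ H
        have e2 : star k * (k * h * star k) * k = h := by
          simp only [mul_assoc, hk.1, mul_one]
          rw [← mul_assoc, hk.1, one_mul]
        rwa [e2]
      · have e2 : c t * star k * (k * h * star k) = a := by
          rw [e]
          calc a * k * star h * star k * (k * h * star k)
              = a * k * star h * (star k * k) * h * star k := by simp only [mul_assoc]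
            _ = a * k * (star h * h) * star k := by rw [hk.1]; simp only [mul_assoc, one_mul]
            _ = a := by rw [(hH.subset hh).1, mul_one, mul_assoc, hk.2, mul_one]
        rwa [e2]
    have hslope' : Tendsto (fun t : ℝ => t⁻¹ • (c t * star k - 1)) (𝓝[>] 0)
        (𝓝 (w * star k)) := by
      refine (hslope.mul_const (star k)).congr fun t => ?_
      rw [smul_mul_assoc, sub_mul, hc0, hk.2]
    obtain ⟨X, hX, Y, hY, e⟩ := velocity_mem_of_product hG hK hcK hslope'
    have hY' : star k * Y * k ∈ lieAlg hH := by
      intro t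
      have h1 := hY t
      change star k * NormedSpace.exp (t • Y) * k ∈ H at h1
      have hks : star k ∈ USet n := Unitary.star_mem (mem_unitary_of_mem_USet hk)
      have h2 := exp_unitary_conj hks (t • Y)
      rw [star_star] at h2
      rw [← h2] at h1
      simpa [Matrix.mul_smul, Matrix.smul_mul] using h1
    refine ⟨(⟨X, hX⟩, ⟨_, hY'⟩), ?_⟩
    change X * k - k * (star k * Y * k) = w
    calc X * k - k * (star k * Y * k) = X * k - (k * star k) * Y * k := by simp only [mul_assoc]
      _ = (X - Y) * k := by rw [hk.2, one_mul, sub_mul]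
      _ = w := by rw [← e, mul_assoc, hk.1, mul_one]
  calc _ ≤ finrank ℝ (LinearMap.range f) := Submodule.finrank_mono hle
    _ ≤ finrank ℝ (lieAlg hG × lieAlg hH) := LinearMap.finrank_range_le f
    _ = _ := Module.finrank_prod

theorem sq_le_grpDim_USet : n ^ 2 ≤ grpDim (USet n) := by
  rw [← finrank_skewAdjoint_matrix n]
  refine Submodule.finrank_mono fun X hX => Submodule.subset_span ?_
  refine ⟨fun t => NormedSpace.exp (t • X), fun t => ?_, by simp, fun i j => ?_⟩
  · exact exp_skew_mem_USet (star_smul_of_skew hX t)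
  · have h := hasDerivAt_exp_smul_const (𝕂 := ℝ) X 0
    rw [zero_smul, NormedSpace.exp_zero, one_mul] at h
    exact hasDerivAt_entries h i j

theorem sq_le_of_lrCohomogeneity_le_one (hG : IsClosedUnitarySubgroup G)
    (hH : IsClosedUnitarySubgroup H) (hcoh : lrCohomogeneity G H (USet n) ≤ 1) :
    n ^ 2 ≤ finrank ℝ (lieAlg hG) + finrank ℝ (lieAlg hH) + 1 := by
  have h : (⨆ k : USet n, finrank ℝ (matTangentAt (lrOrbit G H k)
      (k : Matrix (Fin n) (Fin n) ℂ))) ≤ finrank ℝ (lieAlg hG) + finrank ℝ (lieAlg hH) :=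
    ciSup_le' fun k => finrank_tangent_lrOrbit_le hG hH k.2
  have h2 := sq_le_grpDim_USet (n := n)
  unfold lrCohomogeneity at hcoh
  omega

end ClosedSubgroups

section PrincipalIsotropy

open scoped Matrix.Norms.L2Operator

variable {n : ℕ}

theorem altPrincipalIsotropy_mul_apply {A : Matrix (Fin n) (Fin n) ℂ}
    (hA : A ∈ AltPrincipalIsotropy n) (B : Matrix (Fin n) (Fin n) ℂ) {k : ℕ}
    (h : 2 * k + 1 < n) {i : Fin n} (hi : (i : ℕ) / 2 = k) (j : Fin n) :
    (A * B) i j = A i ⟨2 * k, by omega⟩ * B ⟨2 * k, by omega⟩ j +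
      A i ⟨2 * k + 1, h⟩ * B ⟨2 * k + 1, h⟩ j := by
  rw [Matrix.mul_apply]
  refine Fintype.sum_eq_add _ _ (by simp [Fin.ext_iff]) fun x hx => ?_
  have h1 := hx.1
  have h2 := hx.2
  rw [ne_eq, Fin.ext_iff] at h1 h2
  simp only at h1 h2
  rw [hA.2.1 i x (by omega), zero_mul]

theorem isClosedUnitarySubgroup_altPrincipalIsotropy :
    IsClosedUnitarySubgroup (AltPrincipalIsotropy n) where
  subset A hA := hA.1
  one_mem := by
    refine ⟨by simp [USet], fun i j hij => Matrix.one_apply_ne fun e => hij (by rw [e]), ?_⟩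
    intro k h
    simp [Fin.ext_iff]
  mul_mem A hA B hB := by
    refine ⟨MulMemClass.mul_mem (mem_unitary_of_mem_USet hA.1) (mem_unitary_of_mem_USet hB.1),
      fun i j hij => ?_, fun k h => ?_⟩
    · rw [Matrix.mul_apply]
      refine Finset.sum_eq_zero fun l _ => ?_
      by_cases hl : (i : ℕ) / 2 = (l : ℕ) / 2
      · rw [hB.2.1 l j (by omega), mul_zero]
      · rw [hA.2.1 i l hl, zero_mul]
    · rw [altPrincipalIsotropy_mul_apply hA B h (by simp only; omega),
        altPrincipalIsotropy_mul_apply hA B h (by simp only; omega),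
        altPrincipalIsotropy_mul_apply hA B h (by simp only; omega),
        altPrincipalIsotropy_mul_apply hA B h (by simp only; omega)]
      have h1 := hA.2.2 k h
      have h2 := hB.2.2 k h
      linear_combination (B ⟨2 * k, by omega⟩ ⟨2 * k, by omega⟩ *
        B ⟨2 * k + 1, h⟩ ⟨2 * k + 1, h⟩ -
        B ⟨2 * k, by omega⟩ ⟨2 * k + 1, h⟩ * B ⟨2 * k + 1, h⟩ ⟨2 * k, by omega⟩) * h1 + h2
  star_mem A hA := by
    refine ⟨Unitary.star_mem (mem_unitary_of_mem_USet hA.1), fun i j hij => ?_, fun k h => ?_⟩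
    · rw [Matrix.star_apply, hA.2.1 j i hij.symm, star_zero]
    · have h1 := congrArg star (hA.2.2 k h)
      simp only [star_sub, star_mul', star_one] at h1
      simp only [Matrix.star_apply]
      linear_combination h1
  isClosed := by
    have hentry : ∀ i j : Fin n, Continuous fun A : Matrix (Fin n) (Fin n) ℂ => A i j :=
      fun i j => continuous_id.matrix_elem i j
    have e : AltPrincipalIsotropy n = (({A | star A * A = 1} ∩ {A | A * star A = 1}) ∩
        ⋂ (i : Fin n) (j : Fin n) (_ : (i : ℕ) / 2 ≠ (j : ℕ) / 2), {A | A i j = 0}) ∩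
        ⋂ (k : ℕ) (h : 2 * k + 1 < n),
          {A | A ⟨2 * k, by omega⟩ ⟨2 * k, by omega⟩ * A ⟨2 * k + 1, h⟩ ⟨2 * k + 1, h⟩ -
            A ⟨2 * k, by omega⟩ ⟨2 * k + 1, h⟩ * A ⟨2 * k + 1, h⟩ ⟨2 * k, by omega⟩ = 1} := by
      ext A
      simp only [AltPrincipalIsotropy, USet, Set.mem_inter_iff, Set.mem_iInter, and_assoc,
        Set.mem_ofPred_eq]
    rw [e]
    exact (((isClosed_eq (continuous_star.mul continuous_id) continuous_const).inter
      (isClosed_eq (continuous_id.mul continuous_star) continuous_const)).inter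
      (isClosed_iInter fun i => isClosed_iInter fun j => isClosed_iInter fun _ =>
        isClosed_eq (hentry i j) continuous_const)).inter
      (isClosed_iInter fun k => isClosed_iInter fun h =>
        isClosed_eq (((hentry _ _).mul (hentry _ _)).sub ((hentry _ _).mul (hentry _ _)))
          continuous_const)

theorem hasDerivAt_exp_entry (X : Matrix (Fin n) (Fin n) ℂ) (i j : Fin n) :
    HasDerivAt (fun t : ℝ => NormedSpace.exp (t • X) i j) (X i j) 0 := by
  have h := hasDerivAt_exp_smul_const (𝕂 := ℝ) X 0
  rw [zero_smul, NormedSpace.exp_zero, one_mul] at h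
  exact hasDerivAt_entries h i j

theorem lieAlg_altPrincipalIsotropy_apply_eq_zero {X : Matrix (Fin n) (Fin n) ℂ}
    (hX : X ∈ lieAlg (isClosedUnitarySubgroup_altPrincipalIsotropy (n := n))) {i j : Fin n}
    (hij : (i : ℕ) / 2 ≠ (j : ℕ) / 2) : X i j = 0 := by
  refine (hasDerivAt_exp_entry X i j).unique ?_
  rw [funext fun t => (hX t).2.1 i j hij]
  exact hasDerivAt_const _ _

theorem lieAlg_altPrincipalIsotropy_block_trace {X : Matrix (Fin n) (Fin n) ℂ}
    (hX : X ∈ lieAlg (isClosedUnitarySubgroup_altPrincipalIsotropy (n := n))) {k : ℕ}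
    (h : 2 * k + 1 < n) : X ⟨2 * k, by omega⟩ ⟨2 * k, by omega⟩ +
      X ⟨2 * k + 1, h⟩ ⟨2 * k + 1, h⟩ = 0 := by
  have hE := hasDerivAt_exp_entry X
  have hd := ((hE ⟨2 * k, by omega⟩ ⟨2 * k, by omega⟩).mul
    (hE ⟨2 * k + 1, h⟩ ⟨2 * k + 1, h⟩)).sub
    ((hE ⟨2 * k, by omega⟩ ⟨2 * k + 1, h⟩).mul (hE ⟨2 * k + 1, h⟩ ⟨2 * k, by omega⟩))
  have hconst := hasDerivAt_const (0 : ℝ) (1 : ℂ)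
  rw [← funext fun t => (hX t).2.2 k h] at hconst
  have e := hd.unique hconst
  simpa [NormedSpace.exp_zero, Matrix.one_apply, Fin.ext_iff] using e

theorem finrank_lieAlg_altPrincipalIsotropy_le :
    finrank ℝ (lieAlg (isClosedUnitarySubgroup_altPrincipalIsotropy (n := n))) ≤ 3 * n / 2 := by
  let f : lieAlg (isClosedUnitarySubgroup_altPrincipalIsotropy (n := n)) →ₗ[ℝ]
      (Fin (n / 2) → ℂ) × (Fin ((n + 1) / 2) → ℝ) :=
    { toFun := fun X => (fun k => X.1 ⟨2 * k, by omega⟩ ⟨2 * k + 1, by omega⟩,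
        fun k => (X.1 ⟨2 * k, by omega⟩ ⟨2 * k, by omega⟩).im)
      map_add' := fun X Y => by ext <;> simp
      map_smul' := fun c X => by ext <;> simp }
  have hf : Function.Injective f := by
    rw [injective_iff_map_eq_zero]
    rintro ⟨X, hX⟩ h0
    have hs : star X = -X := skew_of_exp_mem isClosedUnitarySubgroup_altPrincipalIsotropy hX
    have hoff : ∀ (k : ℕ) (h : 2 * k + 1 < n), X ⟨2 * k, by omega⟩ ⟨2 * k + 1, h⟩ = 0 :=
      fun k h => congrFun (congrArg Prod.fst h0) ⟨k, by omega⟩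
    have hdiag : ∀ (k : ℕ) (h : 2 * k < n), X ⟨2 * k, h⟩ ⟨2 * k, h⟩ = 0 := by
      intro k h
      have him : (X ⟨2 * k, h⟩ ⟨2 * k, h⟩).im = 0 :=
        congrFun (congrArg Prod.snd h0) ⟨k, by omega⟩
      have hre := congrArg Complex.re (skew_apply hs ⟨2 * k, h⟩ ⟨2 * k, h⟩)
      simp at hre
      refine Complex.ext ?_ him
      simp only [Complex.zero_re]
      linarith
    refine Subtype.ext (Matrix.ext fun i j => ?_)
    change X i j = 0
    by_cases hij : (i : ℕ) / 2 = (j : ℕ) / 2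
    · obtain ⟨i, hi⟩ := i
      obtain ⟨j, hj⟩ := j
      simp only at hij
      obtain ⟨k, rfl | rfl⟩ := i.even_or_odd'
      · obtain rfl | rfl : j = 2 * k ∨ j = 2 * k + 1 := by omega
        · exact hdiag k hi
        · exact hoff k hj
      · obtain rfl | rfl : j = 2 * k ∨ j = 2 * k + 1 := by omega
        · have e := skew_apply hs ⟨2 * k + 1, hi⟩ ⟨2 * k, hj⟩
          rw [hoff k hi, star_zero] at e
          exact neg_eq_zero.1 e.symm
        · have e := lieAlg_altPrincipalIsotropy_block_trace hX hi
          rwa [hdiag k (by omega), zero_add] at e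
    · exact lieAlg_altPrincipalIsotropy_apply_eq_zero hX hij
  have h := LinearMap.finrank_le_finrank_of_injective hf
  rw [Module.finrank_prod, Module.finrank_pi_fintype, Module.finrank_pi_fintype] at h
  simp [Complex.finrank_real_complex] at h
  omega

end PrincipalIsotropy

section SpecialUnitary

open scoped Matrix.Norms.L2Operator Topology

variable {n : ℕ} {G : Set (Matrix (Fin n) (Fin n) ℂ)}

theorem exists_unitary_diagonalization_of_isUnit {v : Matrix (Fin n) (Fin n) ℂ}
    (hv : v ∈ USet n) (hdet : (v + 1).det ≠ 0) :
    ∃ U ∈ USet n, ∃ w : Fin n → ℂ, v = U * Matrix.diagonal w * star U := by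
  have hu : IsUnit (v + 1).det := isUnit_iff_ne_zero.2 hdet
  have hvs := hv.1
  set X := (v - 1) * (v + 1)⁻¹ with hXdef
  have hX1 : X * (v + 1) = v - 1 := by
    rw [hXdef, mul_assoc, Matrix.nonsing_inv_mul _ hu, mul_one]
  have hXs : star X = -X := by
    have h1 : star (v + 1) * star X = star (v - 1) := by rw [← star_mul, hX1]
    have h2 : star (v + 1) * (star X + X) * (v + 1) = 0 := by
      rw [mul_add (star (v + 1)), h1, add_mul _ _ (v + 1), mul_assoc, hX1]
      simp only [star_sub, star_add, star_one, sub_mul, mul_sub, add_mul, mul_add, hvs]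
      simp only [one_mul, mul_one]
      abel
    have hus : IsUnit (star (v + 1)).det := by
      rw [Matrix.star_eq_conjTranspose, Matrix.det_conjTranspose]
      exact hu.star
    have h3 : star X + X = (star (v + 1))⁻¹ * (star (v + 1) * (star X + X) * (v + 1)) *
        (v + 1)⁻¹ := by
      simp only [mul_assoc]
      rw [Matrix.mul_nonsing_inv _ hu, mul_one, ← mul_assoc, Matrix.nonsing_inv_mul _ hus,
        one_mul]
    rw [h2, mul_zero, zero_mul] at h3
    exact eq_neg_of_add_eq_zero_left h3
  obtain ⟨U, hU, d, hd⟩ := exists_skew_diagonalization hXs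
  have hU1 : star U * U = 1 := hU.1
  have hU2 : U * star U = 1 := hU.2
  have hne : ∀ i, 1 - Complex.I * (d i : ℂ) ≠ 0 := by
    intro i h
    have := congrArg Complex.re h
    simp at this
  have key : Matrix.diagonal (fun i => 1 - Complex.I * (d i : ℂ)) * (star U * v * U) =
      Matrix.diagonal (fun i => 1 + Complex.I * (d i : ℂ)) := by
    have e1 : Matrix.diagonal (fun i => Complex.I * (d i : ℂ)) = star U * X * U := by
      rw [hd]
      simp only [mul_assoc, hU1, mul_one]
      rw [← mul_assoc, hU1, one_mul]
    have e2 : Matrix.diagonal (fun i => 1 - Complex.I * (d i : ℂ)) = star U * (1 - X) * U := by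
      rw [mul_sub, sub_mul, ← e1, mul_one, hU1, ← Matrix.diagonal_one, Matrix.diagonal_sub]
    have e3 : Matrix.diagonal (fun i => 1 + Complex.I * (d i : ℂ)) = star U * (1 + X) * U := by
      rw [mul_add, add_mul, ← e1, mul_one, hU1, ← Matrix.diagonal_one, Matrix.diagonal_add]
    have e4 : (1 - X) * v = 1 + X := by
      rw [mul_add, mul_one] at hX1
      rw [sub_mul, one_mul, sub_eq_iff_eq_add]
      have : X * v = v - 1 - X := eq_sub_of_add_eq hX1
      rw [this]; abel
    rw [e2, e3, ← e4]
    calc _ = star U * (1 - X) * (U * star U) * v * U := by simp only [mul_assoc]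
      _ = _ := by rw [hU2, mul_one]; simp only [mul_assoc]
  refine ⟨U, hU, fun i => (1 + Complex.I * (d i : ℂ)) / (1 - Complex.I * (d i : ℂ)), ?_⟩
  have key2 : star U * v * U = Matrix.diagonal
      (fun i => (1 + Complex.I * (d i : ℂ)) / (1 - Complex.I * (d i : ℂ))) := by
    ext i j
    have h := congrFun (congrFun key i) j
    rw [Matrix.diagonal_mul] at h
    rw [Matrix.diagonal_apply] at h ⊢
    split_ifs at h ⊢ with hij
    · rw [eq_div_iff (hne i), ← h, mul_comm]
    · exact (mul_eq_zero.1 h).resolve_left (hne i)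
  rw [← key2]
  calc v = (U * star U) * v * (U * star U) := by rw [hU2, one_mul, mul_one]
    _ = _ := by simp only [mul_assoc]

theorem exists_unitary_diagonalization {u : Matrix (Fin n) (Fin n) ℂ} (hu : u ∈ USet n) :
    ∃ U ∈ USet n, ∃ θ : Fin n → ℝ,
      u = U * Matrix.diagonal (fun i => Complex.exp (θ i * Complex.I)) * star U := by
  obtain ⟨z, hz, hroot⟩ : ∃ z ∈ Metric.sphere (0 : ℂ) 1,
      z ∉ ((-u).charpoly.roots.toFinset : Set ℂ) := by
    by_contra! h
    have hfin : (Metric.sphere (0 : ℂ) 1).Finite := (Finset.finite_toSet _).subset h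
    have hrank : 1 < Module.rank ℝ ℂ := by rw [Complex.rank_real_complex]; exact Nat.one_lt_ofNat
    have hsub := hfin.countable.isTotallyDisconnected _ subset_rfl
      (isPreconnected_sphere hrank 0 1)
    have h1 := hsub (x := 1) (by simp) (y := -1) (by simp)
    norm_num at h1
  rw [mem_sphere_zero_iff_norm] at hz
  have hz0 : z ≠ 0 := by rintro rfl; simp at hz
  have hzz : star z * z = 1 := by
    rw [Complex.star_def, mul_comm, Complex.mul_conj, Complex.normSq_eq_norm_sq, hz]; simp
  have hv : star z • u ∈ USet n := by
    constructor
    · rw [star_smul, star_star, smul_mul_smul_comm, hu.1, mul_comm, hzz, one_smul]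
    · rw [star_smul, star_star, smul_mul_smul_comm, hu.2, hzz, one_smul]
  have hdet : (star z • u + 1).det ≠ 0 := by
    have e : star z • u + 1 = star z • (Matrix.scalar (Fin n) z - -u) := by
      rw [smul_sub, smul_neg, sub_neg_eq_add, add_comm]
      congr 1
      rw [Matrix.scalar_apply, ← Matrix.smul_one_eq_diagonal, smul_smul, hzz, one_smul]
    rw [e, Matrix.det_smul, ← Matrix.eval_charpoly]
    refine mul_ne_zero (pow_ne_zero _ (star_ne_zero.2 hz0)) fun h => hroot ?_
    simpa [(Matrix.charpoly_monic (-u)).ne_zero] using h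
  obtain ⟨U, hU, w, hw⟩ := exists_unitary_diagonalization_of_isUnit hv hdet
  have hu' : u = U * Matrix.diagonal (fun i => z * w i) * star U := by
    have e : Matrix.diagonal (fun i => z * w i) = z • Matrix.diagonal w := by
      rw [← Matrix.diagonal_smul]; rfl
    rw [e, Matrix.mul_smul, Matrix.smul_mul, ← hw, smul_smul, mul_comm, hzz, one_smul]
  have hD : star (Matrix.diagonal fun i => z * w i) * (Matrix.diagonal fun i => z * w i) = 1 := by
    have e : (Matrix.diagonal fun i => z * w i) = star U * u * U := by
      rw [hu']
      simp only [mul_assoc, hU.1, mul_one]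
      rw [← mul_assoc, hU.1, one_mul]
    rw [e]
    have hUs : star U ∈ unitary (Matrix (Fin n) (Fin n) ℂ) := Unitary.star_mem hU
    exact (mul_mem (mul_mem hUs (mem_unitary_of_mem_USet hu)) (mem_unitary_of_mem_USet hU)).1
  have hnorm : ∀ i, ‖z * w i‖ = 1 := by
    intro i
    have h := congrFun (congrFun hD i) i
    rw [Matrix.star_eq_conjTranspose, Matrix.diagonal_conjTranspose, Matrix.diagonal_mul_diagonal,
      Matrix.diagonal_apply_eq, Matrix.one_apply_eq, Pi.star_apply, Complex.star_def, mul_comm,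
      Complex.mul_conj, Complex.normSq_eq_norm_sq] at h
    have h2 : ‖z * w i‖ ^ 2 = 1 := by exact_mod_cast h
    exact (pow_eq_one_iff_of_nonneg (norm_nonneg _) two_ne_zero).1 h2
  refine ⟨U, hU, fun i => Complex.arg (z * w i), ?_⟩
  conv_lhs => rw [hu']
  congr 3
  ext i
  have h := Complex.norm_mul_exp_arg_mul_I (z * w i)
  rw [hnorm i] at h
  simpa using h.symm

theorem exp_diagonal_I_mul (θ : Fin n → ℝ) :
    NormedSpace.exp (Matrix.diagonal fun i => Complex.I * (θ i : ℂ)) =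
      Matrix.diagonal fun i => Complex.exp (θ i * Complex.I) := by
  rw [Matrix.exp_diagonal]
  congr 1
  ext i
  rw [Pi.coe_exp, Complex.exp_eq_exp_ℂ, mul_comm]

/-- A set containing all exponentials of traceless skew-Hermitian matrices contains `SU n`. -/
theorem SUSet_subset_of_exp_mem (hn : 0 < n)
    (h : ∀ X : Matrix (Fin n) (Fin n) ℂ, star X = -X → X.trace = 0 → NormedSpace.exp X ∈ G) :
    SUSet n ⊆ G := by
  rintro u ⟨hu, hdet⟩
  obtain ⟨U, hU, θ, rfl⟩ := exists_unitary_diagonalization hu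
  have hprod : Complex.exp ((∑ i, θ i : ℝ) * Complex.I) = 1 := by
    rw [Matrix.det_mul_right_comm, hU.2, one_mul, Matrix.det_diagonal, ← Complex.exp_sum] at hdet
    rw [← hdet]; push_cast; rw [Finset.sum_mul]
  obtain ⟨m, hm⟩ := Complex.exp_eq_one_iff.1 hprod
  have hsum : ∑ i, θ i = 2 * Real.pi * m := by
    have := congrArg Complex.im hm
    simpa [mul_comm] using this
  let θ' : Fin n → ℝ := θ - Pi.single ⟨0, hn⟩ (2 * Real.pi * m)
  have hsum' : ∑ i, θ' i = 0 := by
    simp [θ', Finset.sum_sub_distrib, hsum]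
  have hexp : (fun i => Complex.exp (θ i * Complex.I)) =
      fun i => Complex.exp (θ' i * Complex.I) := by
    ext i
    by_cases hi : i = ⟨0, hn⟩
    · subst hi
      refine Complex.exp_eq_exp_iff_exists_int.2 ⟨m, ?_⟩
      simp [θ']; ring
    · simp [θ', hi]
  rw [hexp, ← exp_diagonal_I_mul, ← exp_unitary_conj hU]
  refine h _ ?_ ?_
  · simp only [star_mul, star_star, mul_assoc, ← mul_neg]
    congr 1
    rw [mul_neg, ← neg_mul, Matrix.star_eq_conjTranspose, Matrix.diagonal_conjTranspose,
      Matrix.diagonal_neg]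
    congr 2
    ext i
    simp
  · rw [Matrix.trace_mul_comm, ← mul_assoc, hU.1, one_mul, Matrix.trace_diagonal,
      ← Finset.mul_sum, ← Complex.ofReal_sum, hsum']
    simp

theorem norm_det_of_mem_USet {u : Matrix (Fin n) (Fin n) ℂ} (hu : u ∈ USet n) : ‖u.det‖ = 1 := by
  have h := congrArg Matrix.det hu.1
  rw [Matrix.det_mul, Matrix.star_eq_conjTranspose, Matrix.det_conjTranspose, Matrix.det_one,
    Complex.star_def, mul_comm, Complex.mul_conj, Complex.normSq_eq_norm_sq] at h
  have h2 : ‖u.det‖ ^ 2 = 1 := by exact_mod_cast h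
  exact (pow_eq_one_iff_of_nonneg (norm_nonneg _) two_ne_zero).1 h2

/-- The angles of the determinants of a closed unitary subgroup. -/
def detAngles (hG : IsClosedUnitarySubgroup G) : AddSubgroup ℝ where
  carrier := {θ | ∃ g ∈ G, g.det = Complex.exp (θ * Complex.I)}
  zero_mem' := ⟨1, hG.one_mem, by simp⟩
  add_mem' := by
    rintro a b ⟨g, hg, h1⟩ ⟨g', hg', h2⟩
    exact ⟨g * g', hG.mul_mem _ hg _ hg', by
      rw [Matrix.det_mul, h1, h2, ← Complex.exp_add]; push_cast; ring_nf⟩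
  neg_mem' := by
    rintro a ⟨g, hg, h1⟩
    refine ⟨star g, hG.star_mem _ hg, ?_⟩
    rw [Matrix.star_eq_conjTranspose, Matrix.det_conjTranspose, h1, Complex.star_def,
      ← Complex.exp_conj]
    simp

theorem isClosed_detAngles (hG : IsClosedUnitarySubgroup G) :
    IsClosed (detAngles hG : Set ℝ) := by
  have hdet : Continuous fun g : Matrix (Fin n) (Fin n) ℂ => g.det := continuous_id.matrix_det
  have h : IsClosed (Matrix.det '' G) := (hG.isCompact.image hdet).isClosed
  exact h.preimage (f := fun θ : ℝ => Complex.exp (θ * Complex.I)) (by fun_prop)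

/-- A connected closed subgroup of `U n` containing `SU n` is `SU n` or `U n`. -/
theorem IsClosedUnitarySubgroup.eq_SUSet (hG : IsClosedUnitarySubgroup G)
    (hconn : IsPreconnected G) (hSU : SUSet n ⊆ G) (hproper : G ≠ USet n) : G = SUSet n := by
  have hangle : ∀ u ∈ USet n, u.det = Complex.exp ((Complex.arg u.det : ℝ) * Complex.I) := by
    intro u hu
    have h := Complex.norm_mul_exp_arg_mul_I u.det
    rw [norm_det_of_mem_USet hu] at h
    simpa using h.symm
  refine Set.Subset.antisymm (fun g hg => ⟨hG.subset hg, ?_⟩) hSU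
  rcases AddSubgroup.dense_or_cyclic (detAngles hG) with hd | ⟨a, ha⟩
  · refine absurd (Set.Subset.antisymm hG.subset fun u hu => ?_) hproper
    have hmem : Complex.arg u.det ∈ (detAngles hG : Set ℝ) := by
      rw [(isClosed_detAngles hG).closure_eq.symm, hd.closure_eq]; trivial
    obtain ⟨g', hg', h1⟩ := hmem
    have hg'U := hG.subset hg'
    have hprod : star g' * u ∈ USet n :=
      MulMemClass.mul_mem (Unitary.star_mem (mem_unitary_of_mem_USet hg'U))
        (mem_unitary_of_mem_USet hu)
    have h2 : (star g' * u).det = 1 := by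
      have h := congrArg Matrix.det hg'U.1
      rwa [Matrix.det_mul, h1, ← hangle u hu, ← Matrix.det_mul, Matrix.det_one] at h
    have h3 := hG.mul_mem _ hg' _ (hSU ⟨hprod, h2⟩)
    rwa [← mul_assoc, hg'U.2, one_mul] at h3
  · have hdet : Continuous fun g : Matrix (Fin n) (Fin n) ℂ => g.det := continuous_id.matrix_det
    have hcount : (Matrix.det '' G).Countable := by
      have hc : (detAngles hG : Set ℝ).Countable := by
        rw [ha, ← AddSubgroup.zmultiples_eq_closure]
        exact Set.countable_range _
      refine (hc.image fun θ : ℝ => Complex.exp (θ * Complex.I)).mono ?_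
      rintro _ ⟨g', hg', rfl⟩
      exact ⟨Complex.arg g'.det, ⟨g', hg', hangle _ (hG.subset hg')⟩,
        (hangle _ (hG.subset hg')).symm⟩
    have hsub := hcount.isTotallyDisconnected _ subset_rfl (hconn.image _ hdet.continuousOn)
    have := hsub (Set.mem_image_of_mem _ hg) (Set.mem_image_of_mem _ hG.one_mem)
    rwa [Matrix.det_one] at this

end SpecialUnitary

theorem statement13 (n : ℕ) (hn : 10 ≤ n)
    (G : Set (Matrix (Fin n) (Fin n) ℂ))
    (hGK : G ⊆ USet n) (hproper : G ≠ USet n)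
    (hgrp : IsMatSubgroup G) (hclosed : IsClosed G) (hconn : IsConnected G)
    (hcoh : lrCohomogeneity G (AltPrincipalIsotropy n) (USet n) ≤ 1) :
    G = SUSet n := by
  have hG : IsClosedUnitarySubgroup G := ⟨hGK, hgrp.1, hgrp.2.1, hgrp.2.2, hclosed⟩
  have hdim := sq_le_of_lrCohomogeneity_le_one hG
    isClosedUnitarySubgroup_altPrincipalIsotropy hcoh
  have hH := finrank_lieAlg_altPrincipalIsotropy_le (n := n)
  refine hG.eq_SUSet hconn.isPreconnected (SUSet_subset_of_exp_mem (by omega) ?_) hproper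
  intro X hX htr
  have hmem := traceless_skew_mem hn (lieAlg_le_skew hG) (bracket_mem_lieAlg hG)
    (by omega) hX htr
  have h := hmem 1
  rwa [one_smul] at h
end

section
/- For n ≥ 2, SU(n) is the unique closed connected subgroup of U(n) of codimension one. -/
/-! Statement 18: for `n ≥ 2`, `SU n` is the unique closed connected subgroup of `U n`
of codimension one (i.e. of dimension `n² - 1`). -/
open Module

section CStar
open Filter Topology NormedSpace

variable {A : Type*} [CStarAlgebra A]

theorem norm_pow_sub_pow_le_of_norm_le_one {R : Type*} [SeminormedRing R] [NormOneClass R]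
    {a b : R} (ha : ‖a‖ ≤ 1) (hb : ‖b‖ ≤ 1) (k : ℕ) : ‖a ^ k - b ^ k‖ ≤ k * ‖a - b‖ := by
  induction k with
  | zero => simp
  | succ k ih =>
    have h : a ^ (k + 1) - b ^ (k + 1) = a ^ k * (a - b) + (a ^ k - b ^ k) * b := by
      rw [pow_succ, pow_succ]; noncomm_ring
    have hak : ‖a ^ k‖ ≤ 1 := (norm_pow_le a k).trans (pow_le_one₀ (norm_nonneg _) ha)
    calc ‖a ^ (k + 1) - b ^ (k + 1)‖ ≤ ‖a ^ k‖ * ‖a - b‖ + ‖a ^ k - b ^ k‖ * ‖b‖ := by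
          rw [h]
          exact (norm_add_le _ _).trans (add_le_add (norm_mul_le _ _) (norm_mul_le _ _))
      _ ≤ 1 * ‖a - b‖ + ‖a ^ k - b ^ k‖ * 1 := by gcongr
      _ ≤ ((k + 1 : ℕ) : ℝ) * ‖a - b‖ := by push_cast; linarith

theorem star_eq_neg_of_hasDerivAt_unitary {c : ℝ → A} {X : A} (hc : ∀ t, c t ∈ unitary A)
    (h0 : c 0 = 1) (hX : HasDerivAt c X 0) : star X = -X := by
  have h1 : HasDerivAt (fun t => star (c t) * c t) (star X * c 0 + star (c 0) * X) 0 :=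
    hX.star.mul hX
  have h2 : (fun t => star (c t) * c t) = fun _ => 1 := funext fun t => (hc t).1
  rw [h2, h0] at h1
  have h3 := h1.unique (hasDerivAt_const _ _)
  simp only [mul_one, star_one, one_mul] at h3
  exact eq_neg_of_add_eq_zero_left h3

theorem exp_smul_mem_unitary {X : A} (hX : star X = -X) (t : ℝ) : exp (t • X) ∈ unitary A := by
  let +nondep : NormedAlgebra ℚ A := .restrictScalars ℚ ℂ A
  apply exp_mem_unitary_of_mem_skewAdjoint
  rw [skewAdjoint.mem_iff, star_smul, hX, star_trivial, smul_neg]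

theorem tendsto_pow_exp_of_hasDerivAt {c : ℝ → A} {X : A} (hc : ∀ t, c t ∈ unitary A)
    (h0 : c 0 = 1) (hX : HasDerivAt c X 0) (t : ℝ) :
    Tendsto (fun k : ℕ => c (t / (k + 1)) ^ (k + 1)) atTop (𝓝 (exp (t • X))) := by
  cases subsingleton_or_nontrivial A
  · exact tendsto_const_nhds.congr fun _ => Subsingleton.elim _ _
  have hsk := star_eq_neg_of_hasDerivAt_unitary hc h0 hX
  have hd : HasDerivAt (fun s : ℝ => c s - exp (s • X)) 0 0 := by
    have := hX.fun_sub (hasDerivAt_exp_smul_const X (0 : ℝ))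
    simpa using this
  have hs : Tendsto (fun k : ℕ => t / ((k : ℝ) + 1)) atTop (𝓝 0) := by
    have := (tendsto_one_div_add_atTop_nhds_zero_nat (𝕜 := ℝ)).const_mul t
    simpa [div_eq_mul_inv] using this
  have ho := (hasDerivAt_iff_isLittleO.1 hd).comp_tendsto hs
  simp only [Function.comp_def, h0, zero_smul, exp_zero, sub_self, sub_zero, smul_zero] at ho
  have hO : (fun k : ℕ => t / ((k : ℝ) + 1)) =O[atTop] fun k : ℕ => ((k : ℝ) + 1)⁻¹ := by
    simp only [div_eq_mul_inv]
    exact Asymptotics.isBigO_const_mul_self _ _ _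
  have h1 := (ho.trans_isBigO hO).norm_left.tendsto_div_nhds_zero
  rw [tendsto_iff_norm_sub_tendsto_zero]
  refine squeeze_zero (fun _ => norm_nonneg _) (fun k => ?_) h1
  have he : exp (t • X) = exp ((t / ((k : ℝ) + 1)) • X) ^ (k + 1) := by
    let +nondep : NormedAlgebra ℚ A := .restrictScalars ℚ ℂ A
    rw [← exp_nsmul, ← Nat.cast_smul_eq_nsmul ℝ, smul_smul]
    congr 2
    push_cast
    field_simp
  rw [he]
  refine (norm_pow_sub_pow_le_of_norm_le_one (CStarRing.norm_of_mem_unitary (hc _)).le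
    (CStarRing.norm_of_mem_unitary (exp_smul_mem_unitary hsk _)).le _).trans_eq ?_
  push_cast
  field_simp

theorem exp_smul_mem_of_hasDerivAt {G : Set A} (hG : G ⊆ unitary A) (hcl : IsClosed G)
    (hmul : ∀ a ∈ G, ∀ b ∈ G, a * b ∈ G) {c : ℝ → A} {X : A} (hc : ∀ t, c t ∈ G)
    (h0 : c 0 = 1) (hX : HasDerivAt c X 0) (t : ℝ) : exp (t • X) ∈ G := by
  have hpow : ∀ a ∈ G, ∀ k : ℕ, a ^ (k + 1) ∈ G := fun a ha k => by
    induction k with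
    | zero => simpa
    | succ k ih => rw [pow_succ]; exact hmul _ ih _ ha
  exact hcl.mem_of_tendsto (tendsto_pow_exp_of_hasDerivAt (fun t => hG (hc t)) h0 hX t)
    (Eventually.of_forall fun k => hpow _ (hc _) k)

theorem hasDerivAt_exp_conj (X Y : A) :
    HasDerivAt (fun t : ℝ => exp (t • X) * Y * exp (t • -X)) (X * Y - Y * X) 0 := by
  have := ((hasDerivAt_exp_smul_const X (0 : ℝ)).mul_const Y).fun_mul
    (hasDerivAt_exp_smul_const (-X) (0 : ℝ))
  simpa [sub_eq_add_neg] using this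

theorem exists_skew_exp_eq_of_finite_spectrum {u : A} (hu : u ∈ unitary A)
    (hfin : (spectrum ℂ u).Finite) : ∃ X : A, star X = -X ∧ exp X = u := by
  have hn : IsStarNormal u := ⟨by rw [commute_iff_eq, hu.1, hu.2]⟩
  have hcont : ∀ f : ℂ → ℂ, ContinuousOn f (spectrum ℂ u) := fun f => hfin.continuousOn f
  refine ⟨cfc (fun z : ℂ => (Complex.I * z.arg : ℂ)) u, ?_, ?_⟩
  · rw [← cfc_star, ← cfc_neg]
    simp
  · rw [← CFC.complex_exp_eq_normedSpace_exp (p := IsStarNormal) (cfc_predicate _ _),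
      ← cfc_comp' Complex.exp _ u (Complex.continuous_exp.continuousOn) (hcont _)]
    conv_rhs => rw [← cfc_id ℂ u]
    refine cfc_congr fun z hz => ?_
    have hz1 : ‖z‖ = 1 := by simpa using spectrum.norm_eq_one_of_unitary hu hz
    have := Complex.norm_mul_exp_arg_mul_I z
    rw [hz1] at this
    simpa [mul_comm] using this

open scoped Matrix.Norms.L2Operator in
theorem Matrix.hasDerivAt_iff {n : ℕ} {c : ℝ → Matrix (Fin n) (Fin n) ℂ}
    {X : Matrix (Fin n) (Fin n) ℂ} {t : ℝ} :
    HasDerivAt c X t ↔ ∀ i j, HasDerivAt (fun t => c t i j) (X i j) t := by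
  have hpi : Tendsto (slope c t) (𝓝[≠] t) (𝓝 X) ↔
      ∀ i, Tendsto (fun s => slope c t s i) (𝓝[≠] t) (𝓝 (X i)) := tendsto_pi_nhds
  rw [hasDerivAt_iff_tendsto_slope, hpi]
  refine forall_congr' fun i => tendsto_pi_nhds.trans (forall_congr' fun j => ?_)
  exact hasDerivAt_iff_tendsto_slope.symm

end CStar

section MatrixLie
open scoped Matrix.Norms.L2Operator Matrix
open NormedSpace Filter Topology Module

variable {n : ℕ}

theorem USet_eq_unitary : USet n = (unitary (Matrix (Fin n) (Fin n) ℂ) : Set _) := rfl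

theorem mem_matTangentAt_one_iff {G : Set (Matrix (Fin n) (Fin n) ℂ)} (hU : G ⊆ USet n)
    (hG : IsMatSubgroup G) (hcl : IsClosed G) {X : Matrix (Fin n) (Fin n) ℂ} :
    X ∈ matTangentAt G 1 ↔ star X = -X ∧ ∀ t : ℝ, exp (t • X) ∈ G := by
  have key : ∀ (c : ℝ → Matrix (Fin n) (Fin n) ℂ) (Y : Matrix (Fin n) (Fin n) ℂ),
      (∀ t, c t ∈ G) → c 0 = 1 → HasDerivAt c Y 0 →
      star Y = -Y ∧ ∀ t : ℝ, exp (t • Y) ∈ G := fun c Y hc h0 hY =>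
    ⟨star_eq_neg_of_hasDerivAt_unitary (fun t => hU (hc t)) h0 hY,
      exp_smul_mem_of_hasDerivAt hU hcl hG.2.1 hc h0 hY⟩
  constructor
  · intro hX
    induction hX using Submodule.span_induction with
    | mem Y hY =>
      obtain ⟨c, hc, h0, hd⟩ := hY
      exact key c Y hc h0 (Matrix.hasDerivAt_iff.2 hd)
    | zero => simpa using hG.1
    | add Y Z _ _ hY hZ =>
      refine key (fun t => exp (t • Y) * exp (t • Z)) _ (fun t => hG.2.1 _ (hY.2 t) _ (hZ.2 t))
        (by simp) ?_
      simpa using (hasDerivAt_exp_smul_const Y (0 : ℝ)).fun_mul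
        (hasDerivAt_exp_smul_const Z (0 : ℝ))
    | smul a Y _ hY =>
      refine ⟨by rw [star_smul, hY.1, star_trivial, smul_neg], fun t => ?_⟩
      rw [smul_smul]
      exact hY.2 _
  · rintro ⟨-, hX⟩
    refine Submodule.subset_span ⟨fun t => exp (t • X), hX, by simp, ?_⟩
    rw [← Matrix.hasDerivAt_iff]
    simpa using hasDerivAt_exp_smul_const X (0 : ℝ)

theorem lie_mem_matTangentAt_one {G : Set (Matrix (Fin n) (Fin n) ℂ)} (hU : G ⊆ USet n)
    (hG : IsMatSubgroup G) (hcl : IsClosed G) {X Y : Matrix (Fin n) (Fin n) ℂ}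
    (hX : X ∈ matTangentAt G 1) (hY : Y ∈ matTangentAt G 1) :
    X * Y - Y * X ∈ matTangentAt G 1 := by
  let +nondep : NormedAlgebra ℚ (Matrix (Fin n) (Fin n) ℂ) := .restrictScalars ℚ ℂ _
  have hmem := fun Z => mem_matTangentAt_one_iff hU hG hcl (X := Z)
  have hinv : ∀ t : ℝ, exp (t • X) * exp (t • -X) = 1 := fun t => by
    rw [← exp_add_of_commute, ← smul_add, add_neg_cancel, smul_zero, exp_zero]
    exact ((Commute.refl X).neg_right.smul_left t).smul_right t
  have hinv' : ∀ t : ℝ, exp (t • -X) * exp (t • X) = 1 := fun t => by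
    simpa using hinv (-t)
  have hstar : ∀ t : ℝ, star (exp (t • X)) = exp (t • -X) := fun t => by
    rw [star_exp, star_smul, ((hmem X).1 hX).1, star_trivial]
  have hconj : ∀ t : ℝ, exp (t • X) * Y * exp (t • -X) ∈ matTangentAt G 1 := fun t => by
    rw [hmem]
    constructor
    · rw [← hstar, star_mul, star_mul, star_star, ((hmem Y).1 hY).1]
      noncomm_ring
    · intro s
      let u : (Matrix (Fin n) (Fin n) ℂ)ˣ := ⟨_, _, hinv t, hinv' t⟩
      have h : s • (exp (t • X) * Y * exp (t • -X)) =
          (u : Matrix (Fin n) (Fin n) ℂ) * (s • Y) *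
            ((u⁻¹ : (Matrix (Fin n) (Fin n) ℂ)ˣ) : Matrix (Fin n) (Fin n) ℂ) := by
        rw [mul_smul_comm, smul_mul_assoc]; rfl
      rw [h, Matrix.exp_units_conj]
      refine hG.2.1 _ (hG.2.1 _ (((hmem X).1 hX).2 t) _ (((hmem Y).1 hY).2 s)) _ ?_
      change exp (t • -X) ∈ G
      rw [← hstar]
      exact hG.2.2 _ (((hmem X).1 hX).2 t)
  have hclosed : IsClosed (matTangentAt G 1 : Set (Matrix (Fin n) (Fin n) ℂ)) :=
    Submodule.closed_of_finiteDimensional _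
  have hlim := (hasDerivAt_iff_tendsto_slope.1 (hasDerivAt_exp_conj X Y))
  refine hclosed.mem_of_tendsto hlim (Eventually.of_forall fun t => ?_)
  rw [slope_def_module]
  exact Submodule.smul_mem _ _ (Submodule.sub_mem _ (hconj t) (hconj 0))

theorem det_exp_of_star_eq_neg {X : Matrix (Fin n) (Fin n) ℂ} (hX : star X = -X) :
    (exp X).det = Complex.exp X.trace := by
  have hH : (-Complex.I • X).IsHermitian := by
    rw [Matrix.IsHermitian, ← Matrix.star_eq_conjTranspose, star_smul, hX]
    simp
  obtain ⟨u, v, huv⟩ : ∃ (u : (Matrix (Fin n) (Fin n) ℂ)ˣ) (v : Fin n → ℂ),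
      X = (u : Matrix (Fin n) (Fin n) ℂ) * Matrix.diagonal v *
        ((u⁻¹ : (Matrix (Fin n) (Fin n) ℂ)ˣ) : Matrix (Fin n) (Fin n) ℂ) := by
    refine ⟨Unitary.toUnits hH.eigenvectorUnitary,
      fun i => Complex.I * hH.eigenvalues i, ?_⟩
    have h := congrArg (fun Y => Complex.I • Y) hH.spectral_theorem
    have hd : Matrix.diagonal (fun i => Complex.I * (hH.eigenvalues i : ℂ)) =
        Complex.I • Matrix.diagonal (RCLike.ofReal ∘ hH.eigenvalues) := by
      rw [← Matrix.diagonal_smul]; rfl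
    rw [hd, mul_smul_comm, smul_mul_assoc]
    rw [Unitary.conjStarAlgAut_apply] at h
    simpa [smul_smul] using h
  have htr : X.trace = ∑ i, v i := by
    rw [huv, Matrix.trace_mul_cycle, Units.inv_mul, one_mul, Matrix.trace_diagonal]
  rw [htr, huv, Matrix.exp_units_conj, Matrix.det_units_conj, Matrix.exp_diagonal,
    Matrix.det_diagonal, Complex.exp_sum]
  simp [Pi.coe_exp, Complex.exp_eq_exp_ℂ]

end MatrixLie

section SkewAdjoint
open Module
open scoped ComplexOrder

variable {n : ℕ}

theorem re_trace_mul_self_eq_zero {W : Matrix (Fin n) (Fin n) ℂ} (hW : star W = -W)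
    (h : (W * W).trace.re = 0) : W = 0 := by
  have him : (W * W).trace.im = 0 := by
    rw [← Complex.conj_eq_iff_im]
    have := Matrix.trace_conjTranspose (W * W)
    rw [Matrix.conjTranspose_mul, ← Matrix.star_eq_conjTranspose, hW, neg_mul_neg] at this
    exact this.symm
  have h0 : (W * W).trace = 0 := Complex.ext h him
  rw [← Matrix.trace_conjTranspose_mul_self_eq_zero_iff, ← Matrix.star_eq_conjTranspose, hW,
    neg_mul, Matrix.trace_neg, h0, neg_zero]

/-- Complex matrices with `Xᴴ = -X`, i.e. the Lie algebra of the unitary group. -/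
noncomputable def skewMatrices (n : ℕ) : Submodule ℝ (Matrix (Fin n) (Fin n) ℂ) :=
  skewAdjoint.submodule ℝ _

/-- Trace-free complex matrices with `Xᴴ = -X`, i.e. the Lie algebra of the special unitary
group. -/
noncomputable def tracelessSkewMatrices (n : ℕ) : Submodule ℝ (Matrix (Fin n) (Fin n) ℂ) :=
  skewMatrices n ⊓ LinearMap.ker (Matrix.traceLinearMap (Fin n) ℝ ℂ)

theorem mem_skewMatrices {X : Matrix (Fin n) (Fin n) ℂ} :
    X ∈ skewMatrices n ↔ star X = -X := Iff.rfl

theorem mem_tracelessSkewMatrices {X : Matrix (Fin n) (Fin n) ℂ} :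
    X ∈ tracelessSkewMatrices n ↔ star X = -X ∧ X.trace = 0 := Iff.rfl

theorem star_trace_of_star_eq_neg {X : Matrix (Fin n) (Fin n) ℂ} (hX : star X = -X) :
    star X.trace = -X.trace := by
  rw [← Matrix.trace_conjTranspose, ← Matrix.star_eq_conjTranspose, hX, Matrix.trace_neg]

theorem sub_star_mem_skewMatrices (M : Matrix (Fin n) (Fin n) ℂ) :
    M - star M ∈ skewMatrices n := by
  simp [mem_skewMatrices]

theorem I_smul_add_star_mem_skewMatrices (M : Matrix (Fin n) (Fin n) ℂ) :
    Complex.I • (M + star M) ∈ skewMatrices n := by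
  rw [mem_skewMatrices]
  simp [add_comm]

theorem two_smul_eq_skew_add (M : Matrix (Fin n) (Fin n) ℂ) :
    (2 : ℂ) • M = (M - star M) + (-Complex.I) • (Complex.I • (M + star M)) := by
  rw [smul_smul, neg_mul, Complex.I_mul_I, neg_neg, one_smul, two_smul]
  abel

theorem finrank_skewMatrices (n : ℕ) : finrank ℝ (skewMatrices n) = n ^ 2 := by
  let e : Matrix (Fin n) (Fin n) ℂ ≃ₗ[ℝ] Matrix (Fin n) (Fin n) ℂ :=
    (LinearEquiv.smulOfNeZero ℂ (Matrix (Fin n) (Fin n) ℂ) Complex.I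
      Complex.I_ne_zero).restrictScalars ℝ
  have he : ∀ X, e X = Complex.I • X := fun X => rfl
  let V := (skewMatrices n).map (e : Matrix (Fin n) (Fin n) ℂ →ₗ[ℝ] Matrix (Fin n) (Fin n) ℂ)
  have hV : finrank ℝ V = finrank ℝ (skewMatrices n) := LinearEquiv.finrank_map_eq e _
  have hinf : skewMatrices n ⊓ V = ⊥ := by
    rw [eq_bot_iff]
    rintro X ⟨hX, Y, hY, rfl⟩
    change star (Complex.I • Y) = -(Complex.I • Y) at hX
    change star Y = -Y at hY
    rw [star_smul, hY] at hX
    have h2 : (2 : ℂ) • (Complex.I • Y) = 0 := by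
      rw [two_smul]
      nth_rewrite 1 [← neg_neg (Complex.I • Y), ← hX]
      simp
    exact (smul_eq_zero.1 h2).resolve_left two_ne_zero
  have hsup : skewMatrices n ⊔ V = ⊤ := by
    rw [eq_top_iff]
    intro M _
    have h2 : (2 : ℝ) • M ∈ skewMatrices n ⊔ V := by
      have : (2 : ℝ) • M = (2 : ℂ) • M := by rw [two_smul, two_smul]
      rw [this, two_smul_eq_skew_add, neg_smul]
      refine Submodule.add_mem_sup (sub_star_mem_skewMatrices M) (Submodule.neg_mem _ ?_)
      exact ⟨_, I_smul_add_star_mem_skewMatrices M, rfl⟩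
    simpa using Submodule.smul_mem _ (2⁻¹ : ℝ) h2
  have h := Submodule.finrank_sup_add_finrank_inf_eq (skewMatrices n) V
  rw [hinf, hsup, hV, finrank_top, finrank_bot, Module.finrank_matrix, Complex.finrank_real_complex,
    Fintype.card_fin] at h
  linarith [pow_two n]

theorem I_smul_one_mem_skewMatrices :
    Complex.I • (1 : Matrix (Fin n) (Fin n) ℂ) ∈ skewMatrices n := by
  rw [mem_skewMatrices]
  simp

theorem finrank_tracelessSkewMatrices (hn : 0 < n) :
    finrank ℝ (tracelessSkewMatrices n) = n ^ 2 - 1 := by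
  have hlt : tracelessSkewMatrices n < skewMatrices n := by
    refine lt_of_le_of_ne inf_le_left fun h => ?_
    have h1 := I_smul_one_mem_skewMatrices (n := n)
    rw [← h, mem_tracelessSkewMatrices] at h1
    simpa [hn.ne'] using h1.2
  have h1 := Submodule.finrank_lt_finrank_of_lt hlt
  have hle : skewMatrices n ≤ tracelessSkewMatrices n ⊔
      Submodule.span ℝ {Complex.I • (1 : Matrix (Fin n) (Fin n) ℂ)} := by
    intro X hX
    have ht := star_trace_of_star_eq_neg hX
    have hre : X.trace.re = 0 := by
      have := congrArg Complex.re ht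
      simp only [Complex.star_def, Complex.conj_re, Complex.neg_re] at this
      linarith
    have hX' : X = (X - (X.trace.im / n) • Complex.I • (1 : Matrix (Fin n) (Fin n) ℂ)) +
        (X.trace.im / n) • Complex.I • (1 : Matrix (Fin n) (Fin n) ℂ) := by abel
    rw [hX']
    refine Submodule.add_mem_sup ⟨Submodule.sub_mem _ hX
      (Submodule.smul_mem _ _ I_smul_one_mem_skewMatrices), ?_⟩
      (Submodule.smul_mem _ _ (Submodule.mem_span_singleton_self _))
    have hn' : (n : ℂ) ≠ 0 := by exact_mod_cast hn.ne'
    rw [SetLike.mem_coe, LinearMap.mem_ker, map_sub, map_smul]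
    simp only [Matrix.traceLinearMap_apply, Matrix.trace_smul, Matrix.trace_one, Fintype.card_fin,
      smul_eq_mul, Complex.real_smul, Complex.ofReal_div, Complex.ofReal_natCast]
    rw [sub_eq_zero]
    field_simp
    apply Complex.ext <;> simp [hre]
  have h2 := Submodule.finrank_mono hle
  have h3 := Submodule.finrank_add_le_finrank_add_finrank (tracelessSkewMatrices n)
    (Submodule.span ℝ {Complex.I • (1 : Matrix (Fin n) (Fin n) ℂ)})
  have h4 := finrank_span_le_card (R := ℝ) {Complex.I • (1 : Matrix (Fin n) (Fin n) ℂ)}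
  rw [Set.toFinset_singleton, Finset.card_singleton] at h4
  rw [finrank_skewMatrices] at h1 h2
  omega

theorem eq_scalar_of_commute_skewMatrices {Z : Matrix (Fin n) (Fin n) ℂ}
    (h : ∀ X ∈ skewMatrices n, Commute Z X) : ∃ z : ℂ, Z = z • 1 := by
  have hall : ∀ M, Commute Z M := fun M => by
    have h2 : Commute Z ((2 : ℂ) • M) := by
      rw [two_smul_eq_skew_add]
      exact (h _ (sub_star_mem_skewMatrices M)).add_right
        ((h _ (I_smul_add_star_mem_skewMatrices M)).smul_right _)
    simpa [smul_smul] using h2.smul_right (2⁻¹ : ℂ)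
  obtain ⟨z, hz⟩ := Matrix.mem_range_scalar_of_commute_single
    (M := Z) fun i j _ => (hall (Matrix.single i j 1)).symm
  exact ⟨z, by rw [← hz, Matrix.scalar_apply, Matrix.smul_one_eq_diagonal]⟩

theorem eq_tracelessSkewMatrices_of_lie_closed (hn : 0 < n)
    {V : Submodule ℝ (Matrix (Fin n) (Fin n) ℂ)} (hV : V ≤ skewMatrices n)
    (hlie : ∀ X ∈ V, ∀ Y ∈ V, X * Y - Y * X ∈ V) (hdim : finrank ℝ V = n ^ 2 - 1) :
    V = tracelessSkewMatrices n := by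
  have hn2 : 0 < n ^ 2 := by positivity
  let B : Matrix (Fin n) (Fin n) ℂ →ₗ[ℝ] Matrix (Fin n) (Fin n) ℂ →ₗ[ℝ] ℝ :=
    (LinearMap.mul ℝ (Matrix (Fin n) (Fin n) ℂ)).compr₂
      (Complex.reLm ∘ₗ Matrix.traceLinearMap (Fin n) ℝ ℂ)
  have hB : ∀ X Y, B X Y = (X * Y).trace.re := fun X Y => rfl
  have hker : LinearMap.ker (B.domRestrict₁₂ (skewMatrices n) V) ≠ ⊥ := by
    apply LinearMap.ker_ne_bot_of_finrank_lt
    rw [Module.finrank_linearMap, finrank_self, hdim, finrank_skewMatrices]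
    omega
  obtain ⟨⟨Z, hZ⟩, hZker, hZ0⟩ := Submodule.exists_mem_ne_zero_of_ne_bot hker
  replace hZ0 : Z ≠ 0 := fun h => hZ0 (Subtype.ext h)
  have horth : ∀ Y ∈ V, (Z * Y).trace.re = 0 := fun Y hY =>
    LinearMap.congr_fun (LinearMap.mem_ker.1 hZker) ⟨Y, hY⟩
  have hZV : Z ∉ V := fun h => hZ0 (re_trace_mul_self_eq_zero hZ (horth Z h))
  have hsup : V ⊔ Submodule.span ℝ {Z} = skewMatrices n := by
    apply Submodule.eq_of_le_of_finrank_le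
    · exact sup_le hV ((Submodule.span_singleton_le_iff_mem _ _).2 hZ)
    · have hlt : V < V ⊔ Submodule.span ℝ {Z} := by
        refine lt_of_le_of_ne le_sup_left fun h => hZV ?_
        rw [h]
        exact Submodule.mem_sup_right (Submodule.mem_span_singleton_self Z)
      have := Submodule.finrank_lt_finrank_of_lt hlt
      rw [finrank_skewMatrices]
      omega
  have hdecomp : ∀ W ∈ skewMatrices n, ∃ Y ∈ V, ∃ r : ℝ, W = Y + r • Z := fun W hW => by
    rw [← hsup, Submodule.mem_sup] at hW
    obtain ⟨Y, hY, Z', hZ', rfl⟩ := hW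
    obtain ⟨r, rfl⟩ := Submodule.mem_span_singleton.1 hZ'
    exact ⟨Y, hY, r, rfl⟩
  have hcomm : ∀ X ∈ V, Commute Z X := fun X hX => by
    have hXs : star X = -X := hV hX
    have hW : star (Z * X - X * Z) = -(Z * X - X * Z) := by
      rw [star_sub, star_mul, star_mul, hXs, show star Z = -Z from hZ]
      noncomm_ring
    obtain ⟨Y, hY, r, hYr⟩ := hdecomp _ hW
    refine sub_eq_zero.1 (re_trace_mul_self_eq_zero hW ?_)
    have h1 : ((Z * X - X * Z) * Y).trace = (Z * (X * Y - Y * X)).trace := by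
      rw [sub_mul, mul_sub, Matrix.trace_sub, Matrix.trace_sub, mul_assoc, mul_assoc X Z Y,
        Matrix.trace_mul_comm X, mul_assoc]
    have h2 : ((Z * X - X * Z) * Z).trace = 0 := by
      rw [sub_mul, Matrix.trace_sub, mul_assoc, Matrix.trace_mul_comm Z, sub_self]
    nth_rewrite 2 [hYr]
    rw [mul_add, mul_smul_comm, Matrix.trace_add, Matrix.trace_smul, h2, smul_zero, add_zero, h1]
    exact horth _ (hlie X hX Y hY)
  obtain ⟨z, rfl⟩ : ∃ z : ℂ, Z = z • 1 := by
    refine eq_scalar_of_commute_skewMatrices fun W hW => ?_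
    obtain ⟨Y, hY, r, rfl⟩ := hdecomp W hW
    exact (hcomm Y hY).add_right ((Commute.refl Z).smul_right r)
  have hz : z.re = 0 := by
    have h1 := congrFun (congrFun (show star (z • 1) = -(z • (1 : Matrix (Fin n) (Fin n) ℂ))
      from hZ) ⟨0, hn⟩) ⟨0, hn⟩
    have h2 := congrArg Complex.re h1
    simp at h2
    linarith
  have hz0 : z.im ≠ 0 := fun h => hZ0 (by rw [show z = 0 from Complex.ext hz h, zero_smul])
  refine Submodule.eq_of_le_of_finrank_le (fun X hX => ⟨hV hX, ?_⟩) ?_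
  · have h1 := horth X hX
    have h2 := congrArg Complex.re (star_trace_of_star_eq_neg (hV hX))
    simp only [Complex.star_def, Complex.conj_re, Complex.neg_re] at h2
    simp only [smul_mul_assoc, one_mul, Matrix.trace_smul, smul_eq_mul, Complex.mul_re, hz,
      zero_mul, zero_sub, neg_eq_zero, mul_eq_zero, hz0, false_or] at h1
    exact Complex.ext (by change X.trace.re = 0; linarith) h1
  · rw [finrank_tracelessSkewMatrices hn, hdim]

end SkewAdjoint

section UnitaryGroups
open scoped Matrix.Norms.L2Operator
open NormedSpace Filter Topology Module

variable {n : ℕ}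

theorem isClosed_USet : IsClosed (USet n) := by
  refine (isClosed_eq ?_ continuous_const).inter (isClosed_eq ?_ continuous_const) <;> fun_prop

theorem isClosed_SUSet : IsClosed (SUSet n) :=
  isClosed_USet.inter (isClosed_eq (continuous_id.matrix_det) continuous_const)

theorem isMatSubgroup_USet : IsMatSubgroup (USet n) :=
  ⟨one_mem (unitary (Matrix (Fin n) (Fin n) ℂ)),
    fun _ ha _ hb => (unitary (Matrix (Fin n) (Fin n) ℂ)).mul_mem ha hb,
    fun _ ha => Unitary.star_mem ha⟩

theorem isMatSubgroup_SUSet : IsMatSubgroup (SUSet n) := by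
  refine ⟨⟨isMatSubgroup_USet.1, Matrix.det_one⟩, fun a ha b hb =>
    ⟨isMatSubgroup_USet.2.1 a ha.1 b hb.1, by rw [Matrix.det_mul, ha.2, hb.2, one_mul]⟩,
    fun a ha => ⟨isMatSubgroup_USet.2.2 a ha.1, ?_⟩⟩
  rw [Matrix.star_eq_conjTranspose, Matrix.det_conjTranspose, ha.2, star_one]

theorem exp_mem_SUSet {X : Matrix (Fin n) (Fin n) ℂ} (hX : X ∈ tracelessSkewMatrices n) :
    exp X ∈ SUSet n := by
  rw [mem_tracelessSkewMatrices] at hX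
  refine ⟨?_, by rw [det_exp_of_star_eq_neg hX.1, hX.2, Complex.exp_zero]⟩
  rw [USet_eq_unitary]
  simpa using exp_smul_mem_unitary hX.1 1

theorem matTangentAt_SUSet_one : matTangentAt (SUSet n) 1 = tracelessSkewMatrices n := by
  ext X
  rw [mem_matTangentAt_one_iff (fun _ h => h.1) isMatSubgroup_SUSet isClosed_SUSet]
  constructor
  · rintro ⟨hX, hexp⟩
    refine ⟨hX, ?_⟩
    have h1 : ∀ t : ℝ, Complex.exp (t • X.trace) = 1 := fun t => by
      rw [← Matrix.trace_smul, ← det_exp_of_star_eq_neg]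
      · exact (hexp t).2
      · rw [star_smul, hX, star_trivial, smul_neg]
    have h2 := hasDerivAt_exp_smul_const X.trace (0 : ℝ)
    simp only [← Complex.exp_eq_exp_ℂ, h1, one_mul] at h2
    exact h2.unique (hasDerivAt_const _ _)
  · intro hX
    exact ⟨hX.1, fun t => exp_mem_SUSet (Submodule.smul_mem _ t hX)⟩

theorem skewMatrices_le_matTangentAt_USet_one : skewMatrices n ≤ matTangentAt (USet n) 1 :=
  fun _ hX => (mem_matTangentAt_one_iff subset_rfl isMatSubgroup_USet isClosed_USet).2
    ⟨hX, exp_smul_mem_unitary hX⟩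

theorem exists_exp_mul_exp_of_mem_SUSet (hn : 0 < n) {A : Matrix (Fin n) (Fin n) ℂ}
    (hA : A ∈ SUSet n) : ∃ X ∈ tracelessSkewMatrices n, ∃ Y ∈ tracelessSkewMatrices n,
      exp X * exp Y = A := by
  obtain ⟨X, hX, rfl⟩ := exists_skew_exp_eq_of_finite_spectrum hA.1 A.finite_spectrum
  have hdet := hA.2
  rw [det_exp_of_star_eq_neg hX] at hdet
  have hstar := star_trace_of_star_eq_neg hX
  set τ := X.trace with hτ
  have hn' : (n : ℂ) ≠ 0 := by exact_mod_cast hn.ne'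
  let C : Matrix (Fin n) (Fin n) ℂ := (τ / n) • 1
  let D : Matrix (Fin n) (Fin n) ℂ := Matrix.diagonal (Pi.single ⟨0, hn⟩ (-τ))
  have hC : star C = -C := by
    simp only [C, star_smul, star_one, star_div₀, hstar, star_natCast, neg_div, neg_smul]
  have hCtr : C.trace = τ := by
    simp only [C, Matrix.trace_smul, Matrix.trace_one, Fintype.card_fin, smul_eq_mul]
    field_simp
  have hD : star D = -D := by
    rw [Matrix.star_eq_conjTranspose, Matrix.diagonal_conjTranspose, Matrix.diagonal_neg]
    congr 1
    ext i
    rw [Pi.star_apply]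
    rcases eq_or_ne i ⟨0, hn⟩ with rfl | hi
    · rw [Pi.single_eq_same, star_neg, hstar]
    · rw [Pi.single_eq_of_ne hi, star_zero, neg_zero]
  have hDtr : D.trace = -τ := by
    simp [D, Matrix.trace_diagonal]
  have hDexp : exp D = 1 := by
    rw [Matrix.exp_diagonal, ← Matrix.diagonal_one]
    congr 1
    ext i
    rw [Pi.coe_exp, ← Complex.exp_eq_exp_ℂ]
    by_cases hi : i = ⟨0, hn⟩
    · subst hi
      rw [Pi.single_eq_same, Complex.exp_neg, hdet, inv_one]
    · rw [Pi.single_eq_of_ne hi, Complex.exp_zero]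
  have hCcomm : ∀ M, Commute C M := fun M => (Commute.one_left M).smul_left _
  refine ⟨X - C, ⟨Submodule.sub_mem _ hX hC, ?_⟩, C + D, ⟨Submodule.add_mem _ hC hD, ?_⟩, ?_⟩
  · change (X - C).trace = 0
    rw [Matrix.trace_sub, hCtr, sub_self]
  · change (C + D).trace = 0
    rw [Matrix.trace_add, hCtr, hDtr, add_neg_cancel]
  · rw [Matrix.exp_add_of_commute C D (hCcomm D), hDexp, mul_one,
      ← Matrix.exp_add_of_commute _ _ (hCcomm _).symm, sub_add_cancel]

theorem isConnected_SUSet (hn : 0 < n) : IsConnected (SUSet n) := by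
  let +nondep : NormedAlgebra ℚ (Matrix (Fin n) (Fin n) ℂ) := .restrictScalars ℚ ℂ _
  let S : Set (Matrix (Fin n) (Fin n) ℂ) := tracelessSkewMatrices n
  have hS : IsConnected S :=
    ⟨⟨0, Submodule.zero_mem _⟩, (tracelessSkewMatrices n).convex.isPreconnected⟩
  have himg : SUSet n = (fun p : Matrix (Fin n) (Fin n) ℂ × Matrix (Fin n) (Fin n) ℂ =>
      exp p.1 * exp p.2) '' (S ×ˢ S) := by
    ext A
    constructor
    · intro hA
      obtain ⟨X, hX, Y, hY, h⟩ := exists_exp_mul_exp_of_mem_SUSet hn hA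
      exact ⟨(X, Y), ⟨hX, hY⟩, h⟩
    · rintro ⟨⟨X, Y⟩, ⟨hX, hY⟩, rfl⟩
      exact isMatSubgroup_SUSet.2.1 _ (exp_mem_SUSet hX) _ (exp_mem_SUSet hY)
  rw [himg]
  refine (hS.prod hS).image _ (Continuous.continuousOn ?_)
  exact (exp_continuous.comp continuous_fst).mul (exp_continuous.comp continuous_snd)

theorem isCompact_of_isClosed_of_subset_USet {G : Set (Matrix (Fin n) (Fin n) ℂ)}
    (hU : G ⊆ USet n) (hcl : IsClosed G) : IsCompact G := by
  have : ProperSpace (Matrix (Fin n) (Fin n) ℂ) := FiniteDimensional.proper ℂ _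
  refine (isCompact_closedBall (0 : Matrix (Fin n) (Fin n) ℂ) 1).of_isClosed_subset hcl
    fun a ha => ?_
  rw [mem_closedBall_zero_iff]
  cases subsingleton_or_nontrivial (Matrix (Fin n) (Fin n) ℂ)
  · rw [Subsingleton.elim a 0, norm_zero]
    exact zero_le_one
  · exact (CStarRing.norm_of_mem_unitary (hU ha)).le

theorem norm_det_of_mem_USet_s18 {A : Matrix (Fin n) (Fin n) ℂ} (hA : A ∈ USet n) : ‖A.det‖ = 1 :=
  CStarRing.norm_of_mem_unitary (Matrix.det_of_mem_unitary hA)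

theorem det_eq_one_or_det_surjOn {G : Set (Matrix (Fin n) (Fin n) ℂ)} (hU : G ⊆ USet n)
    (hG : IsMatSubgroup G) (hcl : IsClosed G) (hconn : IsConnected G) :
    (∀ a ∈ G, a.det = 1) ∨ ∀ z : ℂ, ‖z‖ = 1 → ∃ a ∈ G, a.det = z := by
  have hdet : Continuous (Matrix.det : Matrix (Fin n) (Fin n) ℂ → ℂ) := continuous_id.matrix_det
  let S : AddSubgroup ℝ :=
    { carrier := {θ | ∃ a ∈ G, a.det = Complex.exp (θ * Complex.I)}
      zero_mem' := ⟨1, hG.1, by simp⟩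
      add_mem' := by
        rintro θ φ ⟨a, ha, hθ⟩ ⟨b, hb, hφ⟩
        exact ⟨a * b, hG.2.1 a ha b hb, by
          rw [Matrix.det_mul, hθ, hφ, ← Complex.exp_add]; push_cast; ring_nf⟩
      neg_mem' := by
        rintro θ ⟨a, ha, hθ⟩
        refine ⟨star a, hG.2.2 a ha, ?_⟩
        rw [Matrix.star_eq_conjTranspose, Matrix.det_conjTranspose, hθ, Complex.star_def,
          ← Complex.exp_conj]
        simp }
  have harg : ∀ z : ℂ, ‖z‖ = 1 → Complex.exp (z.arg * Complex.I) = z := fun z hz => by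
    simpa [hz] using Complex.norm_mul_exp_arg_mul_I z
  rcases S.dense_or_cyclic with hd | ⟨α, hα⟩
  · right
    have hSc : IsClosed (S : Set ℝ) := by
      have himg : IsClosed (Matrix.det '' G) :=
        ((isCompact_of_isClosed_of_subset_USet hU hcl).image hdet).isClosed
      exact himg.preimage (f := fun θ : ℝ => Complex.exp (θ * Complex.I)) (by fun_prop)
    have hSu : (S : Set ℝ) = Set.univ := by rw [← hSc.closure_eq, hd.closure_eq]
    intro z hz
    obtain ⟨a, ha, h⟩ : z.arg ∈ (S : Set ℝ) := hSu ▸ Set.mem_univ _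
    exact ⟨a, ha, h.trans (harg z hz)⟩
  · left
    have hcount : (Matrix.det '' G).Countable := by
      refine (Set.countable_range fun k : ℤ =>
        Complex.exp ((k • α : ℝ) * Complex.I)).mono ?_
      rintro _ ⟨a, ha, rfl⟩
      have hz := harg _ (norm_det_of_mem_USet_s18 (hU ha))
      have hmem : a.det.arg ∈ S := ⟨a, ha, hz.symm⟩
      rw [hα, AddSubgroup.mem_closure_singleton] at hmem
      obtain ⟨k, hk⟩ := hmem
      exact ⟨k, by simp only [hk]; exact hz⟩
    have hsub : (Matrix.det '' G).Subsingleton := hcount.isTotallyDisconnected _ subset_rfl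
      (hconn.isPreconnected.image _ hdet.continuousOn)
    intro a ha
    exact hsub ⟨a, ha, rfl⟩ ⟨1, hG.1, Matrix.det_one⟩

theorem eq_SUSet_of_finrank_matTangentAt (hn : 0 < n) {G : Set (Matrix (Fin n) (Fin n) ℂ)}
    (hU : G ⊆ USet n) (hG : IsMatSubgroup G) (hcl : IsClosed G) (hconn : IsConnected G)
    (hdim : finrank ℝ (matTangentAt G 1) = n ^ 2 - 1) : G = SUSet n := by
  have htan : matTangentAt G 1 = tracelessSkewMatrices n :=
    eq_tracelessSkewMatrices_of_lie_closed hn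
      (fun X hX => ((mem_matTangentAt_one_iff hU hG hcl).1 hX).1)
      (fun X hX Y hY => lie_mem_matTangentAt_one hU hG hcl hX hY) hdim
  have hexp : ∀ X ∈ tracelessSkewMatrices n, exp X ∈ G := fun X hX => by
    rw [← htan, mem_matTangentAt_one_iff hU hG hcl] at hX
    simpa using hX.2 1
  have hSU : SUSet n ⊆ G := fun A hA => by
    obtain ⟨X, hX, Y, hY, rfl⟩ := exists_exp_mul_exp_of_mem_SUSet hn hA
    exact hG.2.1 _ (hexp X hX) _ (hexp Y hY)
  refine subset_antisymm ?_ hSU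
  rcases det_eq_one_or_det_surjOn hU hG hcl hconn with h | h
  · exact fun A hA => ⟨hU hA, h A hA⟩
  · exfalso
    have hGU : G = USet n := by
      refine subset_antisymm hU fun B hB => ?_
      obtain ⟨a, ha, hdet⟩ := h _ (norm_det_of_mem_USet_s18 hB)
      have hmem : B * star a ∈ SUSet n := by
        refine ⟨isMatSubgroup_USet.2.1 _ hB _ (isMatSubgroup_USet.2.2 _ (hU ha)), ?_⟩
        rw [Matrix.det_mul, ← hdet, ← Matrix.det_mul, (hU ha).2, Matrix.det_one]
      have := hG.2.1 _ (hSU hmem) _ ha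
      rwa [mul_assoc, (hU ha).1, mul_one] at this
    have hle := Submodule.finrank_mono (skewMatrices_le_matTangentAt_USet_one (n := n))
    rw [← hGU, hdim, finrank_skewMatrices] at hle
    have : 0 < n ^ 2 := by positivity
    omega

end UnitaryGroups

open Module in
theorem statement18 (n : ℕ) (hn : 2 ≤ n) :
    -- `SU n` is a closed connected subgroup of `U n` of codimension one ...
    (SUSet n ⊆ USet n ∧ IsMatSubgroup (SUSet n) ∧ IsClosed (SUSet n) ∧
      IsConnected (SUSet n) ∧ finrank ℝ (matTangentAt (SUSet n) 1) = n ^ 2 - 1) ∧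
    -- ... and it is the only one
    ∀ G : Set (Matrix (Fin n) (Fin n) ℂ),
      G ⊆ USet n → IsMatSubgroup G → IsClosed G → IsConnected G →
      finrank ℝ (matTangentAt G 1) = n ^ 2 - 1 →
      G = SUSet n := by
  have hn0 : 0 < n := by omega
  refine ⟨⟨fun _ h => h.1, isMatSubgroup_SUSet, isClosed_SUSet, isConnected_SUSet hn0, ?_⟩,
    fun G hU hG hcl hconn hdim => eq_SUSet_of_finrank_matTangentAt hn0 hU hG hcl hconn hdim⟩
  rw [matTangentAt_SUSet_one, finrank_tracelessSkewMatrices hn0]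
end
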